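/- arXiv:math/0606076 — 8 statements merged into one kernel-verified Lean document; each statement's English description precedes it below -/
import Mathlib

section
/- Let k be a commutative ring, H a commutative Hopf k-algebra with multiplication m_H, comultiplication Δ and counit ε_H, equipped with k-submodules H^(n) (n ≥ 0) such that H^(0) = k·1, H^(n) ⊆ H^(n+1), ⋃_{n≥0} H^(n) = H, H^(p)·H^(q) ⊆ H^(p+q) for all p,q, and Δ(H^(n)) ⊆ ∑_{p+q=n} H^(p) ⊗ H^(q) (i.e. H is a commutative connected filtered Hopf algebra). Let R be a commutative k-algebra and P : R → R a k-linear map satisfying the Rota–Baxter identity of weight −1: P(x)P(y) = P(x·P(y)) + P(P(x)·y) − P(x·y) for all x, y ∈ R, and let φ : H → R be a k-algebra homomorphism. Then there exist k-algebra homomorphisms φ₋ : H → R whose image is contained in k·1_R + P(R) and φ₊ : H → R whose image is contained in k·1_R + (id − P)(R) such that φ₋ ⋆ φ = φ₊, where ⋆ denotes the convolution product of k-linear maps from H to R: (f ⋆ g)(x) = m_R ∘ (f ⊗ g) ∘ Δ(x). (This identity φ₋ ⋆ φ = φ₊ is the Algebraic Birkhoff Decomposition φ = φ₋^{⋆(−1)}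 ⋆ φ₊.) -/
open TensorProduct

/-- The convolution product of two `k`-linear maps from a coalgebra `H` to an algebra `R`:
`f ⋆ g = m_R ∘ (f ⊗ g) ∘ Δ`. -/
noncomputable def convProd {k H R : Type*} [CommRing k] [AddCommGroup H] [Module k H]
    [Coalgebra k H] [CommRing R] [Algebra k R] (f g : H →ₗ[k] R) : H →ₗ[k] R :=
  LinearMap.mul' k R ∘ₗ TensorProduct.map f g ∘ₗ Coalgebra.comul

/-- A linear endomorphism `T` of `Hom(H, M)` that improves the order of vanishing along an
exhaustive filtration `F` of `H` makes every affine equation `ψ = e + T ψ` solvable. -/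
theorem LinearMap.exists_eq_add_apply_of_contracting {k H M : Type*} [CommRing k]
    [AddCommGroup H] [Module k H] [AddCommGroup M] [Module k M]
    (F : ℕ → Submodule k H) (hF : ∀ x, ∃ n, x ∈ F n)
    (T : (H →ₗ[k] M) →ₗ[k] (H →ₗ[k] M))
    (hT : ∀ f n, (∀ m < n, ∀ x ∈ F m, f x = 0) → ∀ x ∈ F n, T f x = 0)
    (e : H →ₗ[k] M) : ∃ ψ : H →ₗ[k] M, ψ = e + T ψ := by
  have hvan (i : ℕ) : ∀ n < i, ∀ x ∈ F n, (T ^ i) e x = 0 := by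
    induction i with
    | zero => intro n hn; omega
    | succ i ih =>
      intro n hn x hx
      rw [pow_succ', Module.End.mul_apply]
      exact hT _ n (fun m hm => ih m (by omega)) x hx
  have hfin (x : H) : (Function.support fun i => (T ^ i) e x).Finite := by
    obtain ⟨n, hn⟩ := hF x
    refine (Set.finite_Iic n).subset fun i hi => ?_
    by_contra h
    exact hi (hvan i n (not_le.mp h) x hn)
  let ψ : H →ₗ[k] M :=
    { toFun := fun x => ∑ᶠ i, (T ^ i) e x
      map_add' := fun x y => by
        simp only [map_add]
        exact finsum_add_distrib (hfin x) (hfin y)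
      map_smul' := fun c x => by
        simp only [map_smul, RingHom.id_apply]
        exact (smul_finsum' c (hfin x)).symm }
  have hψ (N n : ℕ) (hn : n < N) (x : H) (hx : x ∈ F n) :
      ψ x = (∑ i ∈ Finset.range N, (T ^ i) e) x := by
    rw [LinearMap.sum_apply]
    refine finsum_eq_sum_of_support_subset _ fun i hi => ?_
    by_contra h
    exact hi (hvan i n (by simp at h; omega) x hx)
  refine ⟨ψ, LinearMap.ext fun x => ?_⟩
  obtain ⟨n, hn⟩ := hF x
  have hdiff := hT (ψ - ∑ i ∈ Finset.range n, (T ^ i) e) n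
    (fun m hm y hy => by rw [LinearMap.sub_apply, hψ n m hm y hy, sub_self]) x hn
  rw [map_sub, LinearMap.sub_apply, sub_eq_zero] at hdiff
  rw [LinearMap.add_apply, hdiff, hψ (n + 1) n n.lt_succ_self x hn, Finset.sum_range_succ']
  simp only [pow_succ', Module.End.mul_apply, pow_zero, Module.End.one_apply, map_sum,
    LinearMap.add_apply]
  exact add_comm _ _

/-- A sum of images of `F p ⊗ F (n - p)` is spanned by the pure tensors it contains. -/
theorem sum_range_map_subtype_le_span {k H : Type*} [CommRing k] [AddCommGroup H] [Module k H]
    (F : ℕ → Submodule k H) (n : ℕ) :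
    (∑ p ∈ Finset.range (n + 1),
      LinearMap.range (TensorProduct.map (F p).subtype (F (n - p)).subtype)) ≤
    Submodule.span k {t | ∃ p ≤ n, ∃ a ∈ F p, ∃ b ∈ F (n - p), a ⊗ₜ[k] b = t} := by
  refine Finset.sum_induction _ (· ≤ _) (fun _ _ => sup_le) bot_le fun p hp => ?_
  rw [LinearMap.range_le_iff_comap, eq_top_iff, ← TensorProduct.span_tmul_eq_top,
    Submodule.span_le]
  rintro _ ⟨a, b, rfl⟩
  exact Submodule.subset_span
    ⟨p, Nat.lt_succ_iff.mp (Finset.mem_range.mp hp), a, a.2, b, b.2, rfl⟩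

section ConvProd

variable {k H R : Type*} [CommRing k] [CommRing H] [Bialgebra k H] [CommRing R] [Algebra k R]

/-- The unit-counit map is a right unit for the convolution product. -/
theorem convProd_algebraLinearMap_comp_counit (ψ : H →ₗ[k] R) :
    convProd ψ (Algebra.linearMap k R ∘ₗ Coalgebra.counit) = ψ := by
  have h : LinearMap.mul' k R ∘ₗ
      TensorProduct.map ψ (Algebra.linearMap k R ∘ₗ Coalgebra.counit) =
      ψ ∘ₗ (TensorProduct.rid k H).toLinearMap ∘ₗ
        (Coalgebra.counit (R := k) (A := H)).lTensor H := by
    ext a b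
    simp [mul_comm (ψ a), ← Algebra.smul_def]
  ext x
  have hx := LinearMap.congr_fun h (Coalgebra.comul (R := k) x)
  simpa [convProd] using hx

/-- If `ψ` is multiplicative in total filtration degree below `p + q`, then on `F p × F q` the
multiplicativity defects of `ψ ⋆ φ` and `ψ` agree, for every algebra homomorphism `φ`. -/
theorem convProd_mul_sub_eq {F : ℕ → Submodule k H} (hF0 : F 0 = 1)
    (hΔ : ∀ n, ∀ x ∈ F n, Coalgebra.comul (R := k) x ∈
      Submodule.span k {t | ∃ p ≤ n, ∃ a ∈ F p, ∃ b ∈ F (n - p), a ⊗ₜ[k] b = t})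
    (ψ : H →ₗ[k] R) (φ : H →ₐ[k] R) {p q : ℕ}
    (hψ : ∀ i j, i + j < p + q → ∀ a ∈ F i, ∀ c ∈ F j, ψ (a * c) = ψ a * ψ c)
    {x y : H} (hx : x ∈ F p) (hy : y ∈ F q) :
    convProd ψ φ.toLinearMap (x * y) -
        convProd ψ φ.toLinearMap x * convProd ψ φ.toLinearMap y =
      ψ (x * y) - ψ x * ψ y := by
  have hφ (b : H) (hb : b ∈ F 0) : φ b = algebraMap k R (Coalgebra.counit b) := by
    rw [hF0] at hb
    obtain ⟨c, rfl⟩ := Submodule.mem_one.mp hb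
    simp
  let Θ (f : H →ₗ[k] R) : H ⊗[k] H →ₗ[k] R := LinearMap.mul' k R ∘ₗ TensorProduct.map ψ f
  let e : H →ₗ[k] R := Algebra.linearMap k R ∘ₗ Coalgebra.counit
  have key : ∀ u ∈ Submodule.span k
        {t | ∃ i ≤ p, ∃ a ∈ F i, ∃ b ∈ F (p - i), a ⊗ₜ[k] b = t},
      ∀ v ∈ Submodule.span k
        {t | ∃ i ≤ q, ∃ a ∈ F i, ∃ b ∈ F (q - i), a ⊗ₜ[k] b = t},
      Θ φ.toLinearMap (u * v) - Θ φ.toLinearMap u * Θ φ.toLinearMap v =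
        Θ e (u * v) - Θ e u * Θ e v := by
    intro u hu v hv
    induction hu, hv using Submodule.span_induction₂ with
    | mem_mem u v hu hv =>
      obtain ⟨i, hi, a, ha, b, hb, rfl⟩ := hu
      obtain ⟨j, hj, c, hc, d, hd, rfl⟩ := hv
      simp only [Θ, e, LinearMap.comp_apply, Algebra.TensorProduct.tmul_mul_tmul,
        TensorProduct.map_tmul, LinearMap.mul'_apply, AlgHom.toLinearMap_apply, map_mul,
        Algebra.linearMap_apply, Bialgebra.counit_mul]
      rcases Nat.lt_or_ge (i + j) (p + q) with h | h
      · rw [hψ i j h a ha c hc]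
        ring
      · obtain rfl : i = p := by omega
        obtain rfl : j = q := by omega
        rw [Nat.sub_self] at hb hd
        rw [hφ b hb, hφ d hd]
    | zero_left v hv => simp
    | zero_right u hu => simp
    | add_left u u' v _ _ _ h h' =>
      simp only [add_mul, map_add]
      linear_combination h + h'
    | add_right u v v' _ _ _ h h' =>
      simp only [mul_add, map_add]
      linear_combination h + h'
    | smul_left c u v _ _ h =>
      simp only [smul_mul_assoc, map_smul, ← smul_sub, h]
    | smul_right c u v _ _ h =>
      simp only [mul_smul_comm, map_smul, ← smul_sub, h]
  have h := key _ (hΔ p x hx) _ (hΔ q y hy)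
  rw [← Bialgebra.comul_mul] at h
  have he (z : H) : Θ e (Coalgebra.comul z) = ψ z :=
    LinearMap.congr_fun (convProd_algebraLinearMap_comp_counit ψ) z
  rwa [he, he, he] at h

end ConvProd

/-- **Algebraic Birkhoff decomposition** (existence): for a commutative connected filtered
Hopf algebra `H`, a commutative Rota–Baxter algebra `(R, P)` of weight `-1` and an algebra
homomorphism `φ : H → R`, there exist algebra homomorphisms `φ₋` with image in `k·1 + P(R)`
and `φ₊` with image in `k·1 + (id - P)(R)` such that `φ₋ ⋆ φ = φ₊`. -/
theorem algebraic_birkhoff_decomposition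
    {k H R : Type*} [CommRing k] [CommRing H] [HopfAlgebra k H]
    [CommRing R] [Algebra k R]
    (F : ℕ → Submodule k H)
    (hF0 : F 0 = 1)
    (hFmono : ∀ n, F n ≤ F (n + 1))
    (hFexh : (⨆ n, F n) = ⊤)
    (hFmul : ∀ p q, F p * F q ≤ F (p + q))
    (hFcomul : ∀ n, ∀ x ∈ F n,
      Coalgebra.comul (R := k) x ∈
        ∑ p ∈ Finset.range (n + 1),
          LinearMap.range (TensorProduct.map (F p).subtype (F (n - p)).subtype))
    (P : R →ₗ[k] R)
    (hP : ∀ x y : R, P x * P y = P (x * P y) + P (P x * y) - P (x * y))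
    (φ : H →ₐ[k] R) :
    ∃ φm φp : H →ₐ[k] R,
      (∀ x, φm x ∈ (1 : Submodule k R) ⊔ LinearMap.range P) ∧
      (∀ x, φp x ∈ (1 : Submodule k R) ⊔
        LinearMap.range ((LinearMap.id : R →ₗ[k] R) - P)) ∧
      convProd φm.toLinearMap φ.toLinearMap = φp.toLinearMap := by
  have hΔ (n : ℕ) (x : H) (hx : x ∈ F n) := sum_range_map_subtype_le_span F n (hFcomul n x hx)
  have hF (x : H) : ∃ n, x ∈ F n := by
    rw [← Submodule.mem_iSup_of_directed F (monotone_nat_of_le_succ hFmono).directed_le, hFexh]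
    trivial
  let e : H →ₗ[k] R := Algebra.linearMap k R ∘ₗ Coalgebra.counit
  let A : H →ₗ[k] R := φ.toLinearMap - e
  have hA (b : H) (hb : b ∈ F 0) : A b = 0 := by
    rw [hF0] at hb
    obtain ⟨c, rfl⟩ := Submodule.mem_one.mp hb
    simp [A, e]
  let T : (H →ₗ[k] R) →ₗ[k] (H →ₗ[k] R) :=
    { toFun := fun f => -(P ∘ₗ convProd f A)
      map_add' := fun f g => by
        simp only [convProd, TensorProduct.map_add_left, LinearMap.add_comp, LinearMap.comp_add,
          neg_add]
      map_smul' := fun c f => by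
        simp only [convProd, TensorProduct.map_smul_left, LinearMap.smul_comp, LinearMap.comp_smul,
          smul_neg, RingHom.id_apply] }
  obtain ⟨ψ, hψ⟩ := LinearMap.exists_eq_add_apply_of_contracting F hF T (by
    intro f n hf x hx
    have h : ∀ t ∈ Submodule.span k
        {t | ∃ p ≤ n, ∃ a ∈ F p, ∃ b ∈ F (n - p), a ⊗ₜ[k] b = t},
        (LinearMap.mul' k R ∘ₗ TensorProduct.map f A) t = 0 := by
      intro t ht
      refine Submodule.span_le (p := LinearMap.ker _) |>.mpr ?_ ht
      rintro _ ⟨p, hp, a, ha, b, hb, rfl⟩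
      rcases hp.lt_or_eq with hp | rfl
      · simp [hf p hp a ha]
      · rw [Nat.sub_self] at hb
        simp [hA b hb]
    change -P (convProd f A x) = 0
    rw [show convProd f A x = 0 from h _ (hΔ n x hx), map_zero, neg_zero]) e
  let B : H →ₗ[k] R := convProd ψ A
  have hψB (x : H) : ψ x = algebraMap k R (Coalgebra.counit x) - P (B x) := by
    conv_lhs => rw [hψ]
    exact (sub_eq_add_neg _ _).symm
  have hplus : convProd ψ φ.toLinearMap = ψ + B := by
    have he : convProd ψ e = ψ := convProd_algebraLinearMap_comp_counit ψ
    have hφ : φ.toLinearMap = e + A := (add_sub_cancel _ _).symm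
    calc convProd ψ φ.toLinearMap = convProd ψ e + convProd ψ A := by
          simp only [hφ, convProd, TensorProduct.map_add_right, LinearMap.add_comp,
            LinearMap.comp_add]
      _ = ψ + B := by rw [he]
  have hmul (N : ℕ) : ∀ p q, p + q = N → ∀ x ∈ F p, ∀ y ∈ F q, ψ (x * y) = ψ x * ψ y := by
    induction N using Nat.strong_induction_on with
    | _ N ih =>
      rintro p q rfl x hx y hy
      have h := convProd_mul_sub_eq hF0 hΔ ψ φ (fun i j hij => ih _ hij i j rfl) hx hy
      simp only [hplus, LinearMap.add_apply] at h
      have hB : B (x * y) = B x * B y + algebraMap k R (Coalgebra.counit y) * B x +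
          algebraMap k R (Coalgebra.counit x) * B y - B x * P (B y) - P (B x) * B y := by
        linear_combination h + B x * hψB y + B y * hψB x
      rw [hψB (x * y), hψB x, hψB y, hB]
      simp only [map_add, map_sub, ← Algebra.smul_def, map_smul, Bialgebra.counit_mul, map_mul]
      simp only [Algebra.smul_def]
      linear_combination -hP (B x) (B y)
  have hψmul (x y : H) : ψ (x * y) = ψ x * ψ y := by
    obtain ⟨p, hp⟩ := hF x
    obtain ⟨q, hq⟩ := hF y
    exact hmul _ p q rfl x hp y hq
  have hψone : ψ 1 = 1 := by
    have hB : B 1 = 0 := by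
      simp [B, convProd, Bialgebra.comul_one, Algebra.TensorProduct.one_def, A, e]
    simp [hψB, hB]
  let φm : H →ₐ[k] R := AlgHom.ofLinearMap ψ hψone hψmul
  let φp : H →ₐ[k] R := AlgHom.ofLinearMap (convProd ψ φ.toLinearMap)
    (by simp [convProd, Bialgebra.comul_one, Algebra.TensorProduct.one_def, hψone])
    (fun x y => by
      obtain ⟨p, hp⟩ := hF x
      obtain ⟨q, hq⟩ := hF y
      have h := convProd_mul_sub_eq hF0 hΔ ψ φ (fun i j _ a _ c _ => hψmul a c) hp hq
      rwa [hψmul, sub_self, sub_eq_zero] at h)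
  refine ⟨φm, φp, fun x => ?_, fun x => ?_, LinearMap.ext fun x => rfl⟩
  · refine Submodule.mem_sup.mpr ⟨_, Submodule.mem_one.mpr ⟨Coalgebra.counit x, rfl⟩, _,
      ⟨-B x, rfl⟩, ?_⟩
    rw [map_neg, ← sub_eq_add_neg]
    exact (hψB x).symm
  · refine Submodule.mem_sup.mpr ⟨_, Submodule.mem_one.mpr ⟨Coalgebra.counit x, rfl⟩, _,
      ⟨B x, rfl⟩, ?_⟩
    change _ + (B x - P (B x)) = convProd ψ φ.toLinearMap x
    rw [hplus, LinearMap.add_apply, hψB x]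
    ring
end

section
/- There do not exist an integer n ≥ 1, a real δ > 0, and functions a_0, …, a_{n−1} : ℂ → ℂ, each meromorphic at 0, such that (log(−ε))^n + ∑_{i=0}^{n−1} a_i(ε)·(log(−ε))^i = 0 for all real ε ∈ (−δ, 0). In other words, the germ along the negative real axis of the function ε ↦ log(−ε) is transcendental over the field of germs at 0 of meromorphic functions (equivalently, over the field of convergent Laurent series at 0). -/
open Filter Topology in
/-- Powers of the logarithm are negligible against `ε⁻¹` as `ε → 0⁻`. -/
lemma tendsto_mul_log_neg_pow_nhdsLT_zero (k : ℕ) :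
    Tendsto (fun ε : ℝ => (ε : ℂ) * (Real.log (-ε) : ℂ) ^ k) (𝓝[<] 0) (𝓝 0) := by
  have h_inv : Tendsto (fun ε : ℝ => (-ε)⁻¹) (𝓝[<] 0) atTop := by
    have := tendsto_inv_nhdsLT_zero (𝕜 := ℝ)
    simpa only [inv_neg, Function.comp_def] using tendsto_neg_atBot_atTop.comp this
  have h_log := ((Real.isLittleO_pow_log_id_atTop (n := k)).tendsto_div_nhds_zero.comp
    h_inv).const_mul (-(-1 : ℝ) ^ k)
  have h_real : Tendsto (fun ε : ℝ => ε * Real.log (-ε) ^ k) (𝓝[<] 0) (𝓝 0) := by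
    rw [mul_zero] at h_log
    refine h_log.congr fun ε => ?_
    simp only [Function.comp, Real.log_inv, id, div_inv_eq_mul]
    rw [neg_pow (Real.log (-ε)) k]
    have h_sign : (-1 : ℝ) ^ k * (-1) ^ k = 1 := by rw [← mul_pow]; norm_num
    linear_combination ε * Real.log (-ε) ^ k * h_sign
  have := (Complex.continuous_ofReal.tendsto 0).comp h_real
  simpa [Function.comp_def] using this

open Filter Topology in
lemma tendsto_inv_log_neg_nhdsLT_zero :
    Tendsto (fun ε : ℝ => (Real.log (-ε) : ℂ)⁻¹) (𝓝[<] 0) (𝓝 0) := by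
  have h_log : Tendsto (fun ε : ℝ => Real.log (-ε)) (𝓝[<] 0) atBot := by
    simpa only [Real.log_neg_eq_log] using Real.tendsto_log_nhdsLT_zero
  have := (Complex.continuous_ofReal.tendsto 0).comp (tendsto_inv_atBot_zero.comp h_log)
  simpa [Function.comp_def] using this

open Filter Topology in
lemma tendsto_ofReal_nhdsLT_zero_nhdsNE :
    Tendsto (fun ε : ℝ => (ε : ℂ)) (𝓝[<] 0) (𝓝[≠] 0) := by
  refine tendsto_nhdsWithin_iff.2 ⟨?_, ?_⟩
  · exact_mod_cast (Complex.continuous_ofReal.tendsto 0).mono_left nhdsWithin_le_nhds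
  · filter_upwards [self_mem_nhdsWithin] with ε hε
    simpa using (Set.mem_Iio.1 hε).ne

open Filter Topology in
/-- A meromorphic function of order `m` at `0` is asymptotic to a nonzero multiple of `z ^ m`. -/
lemma exists_tendsto_zpow_neg_mul_of_meromorphicOrderAt_eq {f : ℂ → ℂ} {m : ℤ}
    (hf : MeromorphicAt f 0) (hm : meromorphicOrderAt f 0 = m) :
    ∃ c : ℂ, c ≠ 0 ∧ Tendsto (fun z => z ^ (-m) * f z) (𝓝[≠] 0) (𝓝 c) := by
  obtain ⟨g, hg, hg0, hfg⟩ := (meromorphicOrderAt_eq_int_iff hf).1 hm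
  refine ⟨g 0, hg0, (hg.continuousAt.tendsto.mono_left nhdsWithin_le_nhds).congr' ?_⟩
  filter_upwards [hfg, self_mem_nhdsWithin] with z hz hz0
  have hz0 : z ≠ 0 := hz0
  rw [hz, sub_zero, smul_eq_mul, ← mul_assoc, ← zpow_add₀ hz0]
  simp

open Filter Topology in
lemma exists_tendsto_zpow_neg_mul_of_lt_meromorphicOrderAt {f : ℂ → ℂ} {m : ℤ}
    (hf : MeromorphicAt f 0) (hm : (m : WithTop ℤ) < meromorphicOrderAt f 0) :
    ∃ c : ℂ, Tendsto (fun z => z ^ (-(m + 1)) * f z) (𝓝[≠] 0) (𝓝 c) := by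
  rcases eq_or_ne (meromorphicOrderAt f 0) ⊤ with htop | htop
  · refine ⟨0, tendsto_const_nhds.congr' ?_⟩
    filter_upwards [meromorphicOrderAt_eq_top_iff.1 htop] with z hz
    simp [hz]
  · lift meromorphicOrderAt f 0 to ℤ using htop with n hn
    have hmn : m < n := by exact_mod_cast hm
    obtain ⟨g, hg, -, hfg⟩ := (meromorphicOrderAt_eq_int_iff hf).1 hn.symm
    obtain ⟨k, hk⟩ := Int.eq_ofNat_of_zero_le (show 0 ≤ n - (m + 1) by lia)
    have hcont : ContinuousAt (fun z => z ^ k * g z) 0 :=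
      (continuousAt_id.pow k).mul hg.continuousAt
    refine ⟨_, (hcont.tendsto.mono_left nhdsWithin_le_nhds).congr' ?_⟩
    filter_upwards [hfg, self_mem_nhdsWithin] with z hz hz0
    have hz0 : z ≠ 0 := hz0
    rw [hz, sub_zero, smul_eq_mul, ← mul_assoc, ← zpow_add₀ hz0, ← zpow_natCast]
    congr 2
    lia

open Filter Topology in
/-- A polynomial in `log (-ε)` with meromorphic coefficients, vanishing as `ε → 0⁻`, has all its
coefficients zero near `0`. -/
theorem meromorphicOrderAt_eq_top_of_sum_mul_log_neg_pow_eq_zero {s : Finset ℕ} {b : ℕ → ℂ → ℂ}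
    (hb : ∀ i ∈ s, MeromorphicAt (b i) 0)
    (h : ∀ᶠ ε : ℝ in 𝓝[<] 0, ∑ i ∈ s, b i (ε : ℂ) * (Real.log (-ε) : ℂ) ^ i = 0) :
    ∀ i ∈ s, meromorphicOrderAt (b i) 0 = ⊤ := by
  by_contra! hne
  obtain ⟨i₀, hi₀, hi₀_top⟩ := hne
  obtain ⟨j, hj, hmin⟩ := s.exists_min_image
    (fun i => toLex (meromorphicOrderAt (b i) 0, -(i : ℤ))) ⟨i₀, hi₀⟩
  simp only [Prod.Lex.toLex_le_toLex] at hmin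
  have hj_top : meromorphicOrderAt (b j) 0 ≠ ⊤ := by
    intro htop
    have := hmin i₀ hi₀
    simp [htop, hi₀_top.symm] at this
  obtain ⟨m, hm⟩ := WithTop.ne_top_iff_exists.1 hj_top
  obtain ⟨c, hc, hcj⟩ := exists_tendsto_zpow_neg_mul_of_meromorphicOrderAt_eq (hb j hj) hm.symm
  have hlog_ne : ∀ᶠ ε : ℝ in 𝓝[<] 0, (Real.log (-ε) : ℂ) ≠ 0 := by
    filter_upwards [Ioo_mem_nhdsLT (show (-1 : ℝ) < 0 by norm_num)] with ε hε
    exact_mod_cast (Real.log_neg (by linarith [hε.2]) (by linarith [hε.1])).ne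
  set F : ℕ → ℝ → ℂ := fun i ε =>
    (ε : ℂ) ^ (-m) * (b i ε * (Real.log (-ε) : ℂ) ^ i) * ((Real.log (-ε) : ℂ)⁻¹) ^ j with hF
  have hterm : ∀ i ∈ s, Tendsto (F i) (𝓝[<] 0) (𝓝 (if i = j then c else 0)) := by
    intro i hi
    rcases eq_or_ne i j with rfl | hij
    · rw [if_pos rfl]
      refine (hcj.comp tendsto_ofReal_nhdsLT_zero_nhdsNE).congr' ?_
      filter_upwards [hlog_ne] with ε hε
      simp only [hF, Function.comp]
      rw [mul_assoc, mul_assoc, ← mul_pow, mul_inv_cancel₀ hε, one_pow, mul_one]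
    rw [if_neg hij]
    rcases hmin i hi with hlt | ⟨heq, hle⟩
    · rw [← hm] at hlt
      obtain ⟨d, hd⟩ := exists_tendsto_zpow_neg_mul_of_lt_meromorphicOrderAt (hb i hi) hlt
      have := ((hd.comp tendsto_ofReal_nhdsLT_zero_nhdsNE).mul
        (tendsto_mul_log_neg_pow_nhdsLT_zero i)).mul (tendsto_inv_log_neg_nhdsLT_zero.pow j)
      rw [mul_zero, zero_mul] at this
      refine this.congr' ?_
      filter_upwards [self_mem_nhdsWithin] with ε hε
      have hε0 : (ε : ℂ) ≠ 0 := by exact_mod_cast (Set.mem_Iio.1 hε).ne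
      have hpow : (ε : ℂ) ^ (-m) = (ε : ℂ) ^ (-(m + 1)) * ε := by
        rw [← zpow_add_one₀ hε0]
        congr 1
        ring
      simp only [hF, Function.comp, hpow]
      ring
    · have hlt : i < j := by lia
      obtain ⟨d, -, hd⟩ := exists_tendsto_zpow_neg_mul_of_meromorphicOrderAt_eq (hb i hi)
        (heq.symm.trans hm.symm)
      have := (hd.comp tendsto_ofReal_nhdsLT_zero_nhdsNE).mul
        (tendsto_inv_log_neg_nhdsLT_zero.pow (j - i))
      rw [zero_pow (by lia), mul_zero] at this
      refine this.congr' ?_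
      filter_upwards [hlog_ne] with ε hε
      have hpow : ((Real.log (-ε) : ℂ)⁻¹) ^ j
          = ((Real.log (-ε) : ℂ)⁻¹) ^ i * ((Real.log (-ε) : ℂ)⁻¹) ^ (j - i) := by
        rw [← pow_add, Nat.add_sub_cancel' hlt.le]
      have hcancel : (Real.log (-ε) : ℂ) ^ i * ((Real.log (-ε) : ℂ)⁻¹) ^ i = 1 := by
        rw [← mul_pow, mul_inv_cancel₀ hε, one_pow]
      simp only [hF, Function.comp, hpow]
      linear_combination (-(ε : ℂ) ^ (-m) * b i ε * ((Real.log (-ε) : ℂ)⁻¹) ^ (j - i)) * hcancel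
  have hsum := tendsto_finsetSum s hterm
  rw [Finset.sum_ite_eq' s j, if_pos hj] at hsum
  refine hc (tendsto_nhds_unique hsum (tendsto_const_nhds.congr' ?_))
  filter_upwards [h] with ε hε
  simp only [hF, ← Finset.sum_mul, ← Finset.mul_sum, hε, mul_zero, zero_mul]


/-- `log(-ε)` is transcendental over the field of convergent Laurent series (germs of
functions meromorphic at `0`): there is no monic polynomial relation
`(log(-ε))^n + a_{n-1}(ε)(log(-ε))^{n-1} + ⋯ + a_0(ε) = 0` valid on an interval `(-δ, 0)`
with the `a_i` meromorphic at `0`. -/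
theorem log_neg_transcendental_over_meromorphic :
    ¬ ∃ (n : ℕ) (δ : ℝ) (a : ℕ → ℂ → ℂ),
      1 ≤ n ∧ 0 < δ ∧ (∀ i < n, MeromorphicAt (a i) 0) ∧
      ∀ ε : ℝ, ε ∈ Set.Ioo (-δ) 0 →
        ((Real.log (-ε) : ℂ)) ^ n
          + ∑ i ∈ Finset.range n, a i (ε : ℂ) * ((Real.log (-ε) : ℂ)) ^ i = 0 := by
  rintro ⟨n, δ, a, -, hδ, ha, h⟩
  have htop := meromorphicOrderAt_eq_top_of_sum_mul_log_neg_pow_eq_zero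
    (s := Finset.range (n + 1)) (b := fun i => if i < n then a i else fun _ => 1) ?_ ?_ n (by simp)
  · simp [meromorphicOrderAt_const] at htop
  · intro i _
    split_ifs with hi
    · exact ha i hi
    · exact MeromorphicAt.const 1 0
  · filter_upwards [Ioo_mem_nhdsLT (show -δ < 0 by linarith)] with ε hε
    rw [Finset.sum_range_succ, ← h ε hε, add_comm]
    congr 1
    · simp
    · refine Finset.sum_congr rfl fun i hi => ?_
      rw [if_pos (Finset.mem_range.1 hi)]
end

section
/- Let δ > 0, let M ≥ 0, and let a_0, …, a_M : ℂ → ℂ be meromorphic at 0; let f : (−δ, 0) → ℂ be given by f(ε) = ∑_{n=0}^M a_n(ε)·(log(−ε))^n (a log-Laurent function). Then there is a δ′ with 0 < δ′ ≤ δ such that: (i) f is differentiable on (−δ′, 0) and its derivative f′ is again a log-Laurent function, i.e. f′(ε) = ∑_{n=0}^{M′} b_n(ε)·(log(−ε))^n on (−δ′, 0) for some functions b_n meromorphic at 0; and (ii) f possesses an antiderivative on (−δ′, 0) which is a log-Laurent function, i.e. there are functions c_n meromorphic at 0 and F(ε) = ∑_{n=0}^{M″} c_n(ε)·(log(−ε))^n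 with F′(ε) = f(ε) for all ε ∈ (−δ′, 0). -/
open Filter Topology

/-- The function `t ↦ ∑ aₙ(t)·log(-t)^n`, a finite sum with all `aₙ` meromorphic at `0`. The number
of terms may be taken arbitrarily large. -/
def IsLogLaurent (g : ℝ → ℂ) : Prop :=
  ∃ a : ℕ → ℂ → ℂ, (∀ n, MeromorphicAt (a n) 0) ∧ ∃ M : ℕ, ∀ N ≥ M, ∀ t : ℝ,
    g t = ∑ n ∈ Finset.range (N + 1), a n (t : ℂ) * ((Real.log (-t) : ℂ)) ^ n

namespace IsLogLaurent

lemma monomial {c : ℂ → ℂ} (hc : MeromorphicAt c 0) (n : ℕ) :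
    IsLogLaurent fun t => c (t : ℂ) * ((Real.log (-t) : ℂ)) ^ n := by
  refine ⟨fun m => if m = n then c else 0, fun m => ?_, n, fun N hN t => ?_⟩
  · dsimp only
    split_ifs
    · exact hc
    · exact MeromorphicAt.const 0 0
  · rw [Finset.sum_eq_single_of_mem n (Finset.mem_range.2 (by omega))]
    · simp
    · intro m _ hm
      simp [hm]

lemma add {g h : ℝ → ℂ} (hg : IsLogLaurent g) (hh : IsLogLaurent h) :
    IsLogLaurent fun t => g t + h t := by
  obtain ⟨a, ha, M, hM⟩ := hg
  obtain ⟨b, hb, K, hK⟩ := hh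
  refine ⟨fun n z => a n z + b n z, fun n => (ha n).add (hb n), max M K, fun N hN t => ?_⟩
  dsimp only
  rw [hM N (le_of_max_le_left hN), hK N (le_of_max_le_right hN), ← Finset.sum_add_distrib]
  simp only [add_mul]

lemma sum {ι : Type*} {s : Finset ι} {g : ι → ℝ → ℂ} (hg : ∀ i ∈ s, IsLogLaurent (g i)) :
    IsLogLaurent fun t => ∑ i ∈ s, g i t := by
  classical
  induction s using Finset.induction_on with
  | empty => simpa using monomial (MeromorphicAt.const (0 : ℂ) 0) 0
  | insert i s hi ih =>
    simp only [Finset.sum_insert hi]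
    exact (hg i (by simp)).add (ih fun j hj => hg j (by simp [hj]))

end IsLogLaurent

lemma tendsto_ofReal_nhdsLT_zero :
    Tendsto (fun t : ℝ => (t : ℂ)) (𝓝[<] 0) (𝓝[≠] 0) := by
  refine tendsto_nhdsWithin_iff.2 ⟨?_, ?_⟩
  · exact (Complex.continuous_ofReal.tendsto' 0 0 (by simp)).mono_left nhdsWithin_le_nhds
  · filter_upwards [self_mem_nhdsWithin] with t ht
    simpa using (ne_of_lt ht : t ≠ 0)

lemma AnalyticAt.exists_eventually_hasDerivAt {g : ℂ → ℂ} {x : ℂ} (hg : AnalyticAt ℂ g x) :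
    ∃ G : ℂ → ℂ, AnalyticAt ℂ G x ∧ ∀ᶠ z in 𝓝 x, HasDerivAt G (g z) z := by
  obtain ⟨r, hr, hball⟩ := Metric.eventually_nhds_iff_ball.1 hg.eventually_analyticAt
  have hd : DifferentiableOn ℂ g (Metric.ball x r) := fun z hz =>
    (hball z hz).differentiableAt.differentiableWithinAt
  obtain ⟨G, hG⟩ := hd.isExactOn_ball
  have hev : ∀ᶠ z in 𝓝 x, HasDerivAt G (g z) z := by
    filter_upwards [Metric.ball_mem_nhds x hr] with z hz using hG z hz
  exact ⟨G, Complex.analyticAt_iff_eventually_differentiableAt.2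
    (hev.mono fun z hz => hz.differentiableAt), hev⟩

lemma AnalyticAt.exists_primitive_div_pow (k : ℕ) {g : ℂ → ℂ} (hg : AnalyticAt ℂ g 0) :
    ∃ (c : ℂ → ℂ) (r : ℂ), MeromorphicAt c 0 ∧
      ∀ᶠ z in 𝓝[≠] (0 : ℂ), HasDerivAt c (g z / z ^ k - r / z) z := by
  induction k generalizing g with
  | zero =>
    obtain ⟨G, hG, hev⟩ := hg.exists_eventually_hasDerivAt
    refine ⟨G, 0, hG.meromorphicAt, ?_⟩
    filter_upwards [hev.filter_mono nhdsWithin_le_nhds] with z hz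
    simpa using hz
  | succ k ih =>
    have hh : AnalyticAt ℂ (dslope g 0) 0 := by
      obtain ⟨p, hp⟩ := hg
      exact hp.has_fpower_series_dslope_fslope.analyticAt
    have hgz : ∀ z : ℂ, g z = g 0 + z * dslope g 0 z := fun z => by
      have := sub_smul_dslope g 0 z
      simp only [sub_zero, smul_eq_mul] at this
      rw [this]; ring
    obtain ⟨c, r, hc, hev⟩ := ih hh
    rcases Nat.eq_zero_or_pos k with rfl | hk
    · refine ⟨c, r + g 0, hc, ?_⟩
      filter_upwards [hev, self_mem_nhdsWithin] with z hz hz0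
      have hz0 : z ≠ 0 := hz0
      convert hz using 1
      rw [hgz z]
      field_simp
      ring
    · have hk0 : (k : ℂ) ≠ 0 := by exact_mod_cast hk.ne'
      refine ⟨fun z => c z + (-g 0 / k) * (z ^ k)⁻¹, r,
        hc.add ((MeromorphicAt.const _ 0).mul ((MeromorphicAt.id 0).pow k).inv), ?_⟩
      filter_upwards [hev, self_mem_nhdsWithin] with z hz hz0
      have hz0 : z ≠ 0 := hz0
      have hp := ((hasDerivAt_pow k z).inv (pow_ne_zero k hz0)).const_mul (-g 0 / k)
      refine (hz.add hp).congr_deriv ?_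
      rw [hgz z]
      obtain ⟨j, rfl⟩ : ∃ j, k = j + 1 := ⟨k - 1, by omega⟩
      simp only [Nat.add_sub_cancel]
      field_simp
      ring

/-- A meromorphic germ has a meromorphic primitive once its residue term `r / z` is removed. -/
lemma MeromorphicAt.exists_primitive_sub_residue {a : ℂ → ℂ} (ha : MeromorphicAt a 0) :
    ∃ (c : ℂ → ℂ) (r : ℂ), MeromorphicAt c 0 ∧
      ∀ᶠ z in 𝓝[≠] (0 : ℂ), HasDerivAt c (a z - r / z) z := by
  obtain ⟨k, hk⟩ := ha
  obtain ⟨c, r, hc, hev⟩ := hk.exists_primitive_div_pow k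
  refine ⟨c, r, hc, ?_⟩
  filter_upwards [hev, self_mem_nhdsWithin] with z hz hz0
  have hz0 : z ≠ 0 := hz0
  convert hz using 2
  simp only [sub_zero, smul_eq_mul]
  field_simp

lemma hasDerivAt_mul_log_neg_pow {c : ℂ → ℂ} {c' : ℂ} {t : ℝ} (hc : HasDerivAt c c' t)
    (ht : t ≠ 0) (n : ℕ) :
    HasDerivAt (fun s : ℝ => c s * ((Real.log (-s) : ℂ)) ^ n)
      (c' * (Real.log (-t) : ℂ) ^ n + n * c t / t * (Real.log (-t) : ℂ) ^ (n - 1)) t := by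
  have hlog : HasDerivAt (fun s : ℝ => (Real.log (-s) : ℂ)) ((t : ℂ)⁻¹) t := by
    simpa [Real.log_neg_eq_log] using (Real.hasDerivAt_log ht).ofReal_comp
  refine (hc.comp_ofReal.mul (hlog.pow n)).congr_deriv ?_
  simp only [Pi.pow_apply]
  ring

lemma exists_deriv_monomial {c : ℂ → ℂ} (hc : MeromorphicAt c 0) (n : ℕ) :
    ∃ h : ℝ → ℂ, IsLogLaurent h ∧ ∀ᶠ t : ℝ in 𝓝[<] (0 : ℝ),
      HasDerivAt (fun s : ℝ => c s * ((Real.log (-s) : ℂ)) ^ n) (h t) t := by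
  refine ⟨_, (IsLogLaurent.monomial hc.deriv n).add (IsLogLaurent.monomial
    (((MeromorphicAt.const (n : ℂ) 0).mul hc).div (MeromorphicAt.id 0)) (n - 1)), ?_⟩
  filter_upwards [tendsto_ofReal_nhdsLT_zero.eventually hc.eventually_analyticAt,
    self_mem_nhdsWithin] with t ht ht0
  exact hasDerivAt_mul_log_neg_pow ht.differentiableAt.hasDerivAt (ne_of_lt ht0) n

lemma exists_primitive_monomial (n : ℕ) {a : ℂ → ℂ} (ha : MeromorphicAt a 0) :
    ∃ F : ℝ → ℂ, IsLogLaurent F ∧ ∀ᶠ t : ℝ in 𝓝[<] (0 : ℝ),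
      HasDerivAt F (a t * (Real.log (-t) : ℂ) ^ n) t := by
  induction n generalizing a with
  | zero =>
    obtain ⟨c, r, hc, hev⟩ := ha.exists_primitive_sub_residue
    refine ⟨_, (IsLogLaurent.monomial hc 0).add
      (IsLogLaurent.monomial (MeromorphicAt.const r 0) 1), ?_⟩
    filter_upwards [tendsto_ofReal_nhdsLT_zero.eventually hev, self_mem_nhdsWithin] with t ht ht0
    have ht0 : t ≠ 0 := ne_of_lt ht0
    refine ((hasDerivAt_mul_log_neg_pow ht ht0 0).add
      (hasDerivAt_mul_log_neg_pow (hasDerivAt_const (t : ℂ) r) ht0 1)).congr_deriv ?_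
    simp
  | succ n ih =>
    obtain ⟨c, r, hc, hev⟩ := ha.exists_primitive_sub_residue
    obtain ⟨F, hF, hFev⟩ := ih
      (((MeromorphicAt.const (-(n + 1 : ℂ)) 0).mul hc).div (MeromorphicAt.id 0))
    refine ⟨_, ((IsLogLaurent.monomial hc (n + 1)).add
      (IsLogLaurent.monomial (MeromorphicAt.const (r / (n + 2)) 0) (n + 2))).add hF, ?_⟩
    filter_upwards [tendsto_ofReal_nhdsLT_zero.eventually hev, hFev, self_mem_nhdsWithin]
      with t ht htF ht0
    have ht0 : t ≠ 0 := ne_of_lt ht0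
    refine (((hasDerivAt_mul_log_neg_pow ht ht0 (n + 1)).add
      (hasDerivAt_mul_log_neg_pow (hasDerivAt_const (t : ℂ) (r / (n + 2))) ht0 (n + 2))).add
      htF).congr_deriv ?_
    have h2 : (n : ℂ) + 2 ≠ 0 := by exact_mod_cast (Nat.succ_ne_zero (n + 1))
    have ht0' : (t : ℂ) ≠ 0 := by exact_mod_cast ht0
    simp only [Pi.div_apply, Pi.mul_apply, id_eq, Nat.add_sub_cancel, Nat.add_succ_sub_one]
    push_cast
    field_simp
    ring

/-- Log-Laurent functions (finite sums `∑ aₙ(ε)·log(-ε)^n` with `aₙ` meromorphic at `0`)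
are closed under differentiation and possess log-Laurent antiderivatives, on a possibly
smaller interval `(-δ', 0)`. -/
theorem logLaurent_closed_under_deriv_and_integral
    (δ : ℝ) (hδ : 0 < δ) (M : ℕ) (a : ℕ → ℂ → ℂ)
    (ha : ∀ n ≤ M, MeromorphicAt (a n) 0)
    (f : ℝ → ℂ)
    (hf : ∀ ε : ℝ, ε ∈ Set.Ioo (-δ) 0 →
      f ε = ∑ n ∈ Finset.range (M + 1), a n (ε : ℂ) * ((Real.log (-ε) : ℂ)) ^ n) :
    ∃ δ' : ℝ, 0 < δ' ∧ δ' ≤ δ ∧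
      (∃ (M' : ℕ) (b : ℕ → ℂ → ℂ), (∀ n ≤ M', MeromorphicAt (b n) 0) ∧
        ∀ ε : ℝ, ε ∈ Set.Ioo (-δ') 0 →
          HasDerivAt f
            (∑ n ∈ Finset.range (M' + 1), b n (ε : ℂ) * ((Real.log (-ε) : ℂ)) ^ n) ε) ∧
      (∃ (M'' : ℕ) (c : ℕ → ℂ → ℂ), (∀ n ≤ M'', MeromorphicAt (c n) 0) ∧
        ∀ ε : ℝ, ε ∈ Set.Ioo (-δ') 0 →
          HasDerivAt
            (fun t : ℝ => ∑ n ∈ Finset.range (M'' + 1), c n (t : ℂ) * ((Real.log (-t) : ℂ)) ^ n)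
            (f ε) ε) := by
  have hderiv : ∀ n ∈ Finset.range (M + 1), ∃ h : ℝ → ℂ, IsLogLaurent h ∧
      ∀ᶠ t : ℝ in 𝓝[<] (0 : ℝ),
        HasDerivAt (fun s : ℝ => a n s * ((Real.log (-s) : ℂ)) ^ n) (h t) t := fun n hn =>
    exists_deriv_monomial (ha n (Finset.mem_range_succ_iff.1 hn)) n
  have hprim : ∀ n ∈ Finset.range (M + 1), ∃ F : ℝ → ℂ, IsLogLaurent F ∧
      ∀ᶠ t : ℝ in 𝓝[<] (0 : ℝ), HasDerivAt F (a n t * (Real.log (-t) : ℂ) ^ n) t := fun n hn =>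
    exists_primitive_monomial n (ha n (Finset.mem_range_succ_iff.1 hn))
  choose! h hLL hev using hderiv
  choose! F FLL Fev using hprim
  obtain ⟨b, hb, M', hM'⟩ := IsLogLaurent.sum hLL
  obtain ⟨c, hc, M'', hM''⟩ := IsLogLaurent.sum FLL
  have key := ((Finset.range (M + 1)).eventually_all.2 hev).and
    ((Finset.range (M + 1)).eventually_all.2 Fev)
  obtain ⟨l, hl, hlsub⟩ := mem_nhdsLT_iff_exists_Ioo_subset.1 key
  have hl : l < 0 := hl
  refine ⟨min δ (-l), lt_min hδ (by linarith), min_le_left _ _,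
    ⟨M', b, fun n _ => hb n, fun ε hε => ?_⟩, ⟨M'', c, fun n _ => hc n, fun ε hε => ?_⟩⟩
  all_goals
    have h1 : ε ∈ Set.Ioo (-δ) 0 := ⟨by linarith [hε.1, min_le_left δ (-l)], hε.2⟩
    have h2 := hlsub (⟨by linarith [hε.1, min_le_right δ (-l)], hε.2⟩ : ε ∈ Set.Ioo l 0)
  · rw [← hM' M' le_rfl ε]
    refine (HasDerivAt.fun_sum fun n hn => h2.1 n hn).congr_of_eventuallyEq ?_
    filter_upwards [isOpen_Ioo.mem_nhds h1] with t ht using hf t ht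
  · rw [hf ε h1]
    simp only [← hM'' M'' le_rfl]
    exact HasDerivAt.fun_sum fun n hn => h2.2 n hn
end

section
/- Let k ≥ 1, s = (s_1, …, s_k) ∈ ℤ^k and r = (r_1, …, r_k) ∈ ℤ_{>0}^k. Then the directional regularized multiple zeta value Z(s, r; ε), restricted to real ε < 0, is a log-Laurent function near 0: there exist δ > 0, M ≥ 0 and functions a_0, …, a_M : ℂ → ℂ, each meromorphic at 0, such that Z(s, r; ε) = ∑_{n=0}^M a_n(ε)·(log(−ε))^n for all real ε ∈ (−δ, 0). -/
/-- Strictly decreasing `k`-tuples of positive integers `n₁ > n₂ > ⋯ > n_k > 0`. -/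
def DecSeq (k : ℕ) : Type := {n : Fin k → ℕ // StrictAnti n ∧ ∀ i, 0 < n i}

/-- The directional regularized multiple zeta value
`Z(s, r; ε) = ∑_{n₁ > ⋯ > n_k > 0} ∏ᵢ e^{nᵢ rᵢ ε} / nᵢ^{sᵢ}`. -/
noncomputable def Zreg (k : ℕ) (s : Fin k → ℤ) (r : Fin k → ℝ) (ε : ℂ) : ℂ :=
  ∑' n : DecSeq k, ∏ i, Complex.exp ((n.1 i : ℂ) * (r i : ℂ) * ε) / ((n.1 i : ℂ) ^ (s i))

open Filter Topology

/-- A meromorphic function has, up to its residue, a meromorphic primitive. -/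
theorem MeromorphicAt.exists_primitive {f : ℂ → ℂ} (hf : MeromorphicAt f 0) :
    ∃ (c : ℂ) (F : ℂ → ℂ), MeromorphicAt F 0 ∧
      ∀ᶠ z in 𝓝[≠] (0 : ℂ), HasDerivAt F (f z - c / z) z := by
  have key : ∀ (n : ℕ) (g : ℂ → ℂ), AnalyticAt ℂ g 0 → ∃ (c : ℂ) (F : ℂ → ℂ),
      MeromorphicAt F 0 ∧ ∀ᶠ z in 𝓝[≠] (0 : ℂ), HasDerivAt F (g z / z ^ n - c / z) z := by
    intro n
    induction n with
    | zero =>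
      intro g hg
      obtain ⟨r, hr, hgr⟩ := Metric.eventually_nhds_iff_ball.mp hg.eventually_analyticAt
      have hd : DifferentiableOn ℂ g (Metric.ball 0 r) := fun z hz =>
        (hgr z hz).differentiableAt.differentiableWithinAt
      obtain ⟨F, hF⟩ := hd.isExactOn_ball
      refine ⟨0, F, ?_, ?_⟩
      · refine AnalyticAt.meromorphicAt ?_
        refine DifferentiableOn.analyticAt (s := Metric.ball 0 r) ?_ (Metric.ball_mem_nhds 0 hr)
        exact fun z hz => (hF z hz).differentiableAt.differentiableWithinAt
      · filter_upwards [mem_nhdsWithin_of_mem_nhds (Metric.ball_mem_nhds (0 : ℂ) hr)] with z hz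
        simpa using hF z hz
    | succ n ih =>
      intro g hg
      obtain ⟨p, hp⟩ := hg
      obtain ⟨c, F, hF, hd⟩ := ih (dslope g 0) hp.has_fpower_series_dslope_fslope.analyticAt
      have split : ∀ z : ℂ, z ≠ 0 → g z / z ^ (n + 1) = g 0 / z ^ (n + 1) + dslope g 0 z / z ^ n := by
        intro z hz
        rw [dslope_of_ne _ hz, slope_def_field]
        field_simp
        ring
      rcases Nat.eq_zero_or_pos n with rfl | hn
      · refine ⟨c + g 0, F, hF, ?_⟩
        filter_upwards [hd, self_mem_nhdsWithin] with z hz hz0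
        rw [split z hz0]
        convert hz using 1
        ring
      · refine ⟨c, fun z => F z + -(g 0 / n) * (z ^ n)⁻¹, by fun_prop, ?_⟩
        filter_upwards [hd, self_mem_nhdsWithin] with z hz hz0
        rw [split z hz0]
        have hz0' : z ≠ 0 := hz0
        have hn' : (n : ℂ) ≠ 0 := by exact_mod_cast hn.ne'
        refine (hz.fun_add (((hasDerivAt_pow n z).fun_inv (pow_ne_zero n hz0')).const_mul
          (-(g 0 / n)))).congr_deriv ?_
        obtain ⟨m, rfl⟩ : ∃ m, n = m + 1 := ⟨n - 1, by omega⟩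
        simp only [Nat.add_sub_cancel]
        field_simp
        ring
  obtain ⟨n, hn⟩ := hf
  obtain ⟨c, F, hF, hd⟩ := key n _ hn
  refine ⟨c, F, hF, ?_⟩
  filter_upwards [hd, self_mem_nhdsWithin] with z hz hz0
  have hz0' : z ≠ 0 := hz0
  convert hz using 2
  simp [hz0']

/-- Germs at `0⁻` of polynomials in `log (-ε)` with coefficients meromorphic at `0`. -/
inductive LogLaurent : (ℝ → ℂ) → Prop
  | mul_log_pow (a : ℂ → ℂ) (n : ℕ) : MeromorphicAt a 0 →
      LogLaurent fun ε => a ε * (Real.log (-ε) : ℂ) ^ n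
  | add {f g : ℝ → ℂ} : LogLaurent f → LogLaurent g → LogLaurent fun ε => f ε + g ε
  | congr {f g : ℝ → ℂ} : LogLaurent f → f =ᶠ[𝓝[<] 0] g → LogLaurent g

namespace LogLaurent

variable {f g : ℝ → ℂ}

theorem of_meromorphicAt {a : ℂ → ℂ} (ha : MeromorphicAt a 0) :
    LogLaurent fun ε : ℝ => a ε := by
  simpa using mul_log_pow a 0 ha

theorem const (c : ℂ) : LogLaurent fun _ => c :=
  of_meromorphicAt (a := fun _ => c) (MeromorphicAt.const c 0)

theorem meromorphic_mul {c : ℂ → ℂ} (hc : MeromorphicAt c 0) (hf : LogLaurent f) :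
    LogLaurent fun ε => c ε * f ε := by
  induction hf with
  | mul_log_pow a n ha =>
    simpa only [Pi.mul_apply, mul_assoc] using mul_log_pow (c * a) n (hc.mul ha)
  | add _ _ ihf ihg => simpa only [mul_add] using ihf.add ihg
  | congr _ h ih => exact ih.congr (h.mono fun ε hε => by simp only [hε])

theorem listSum {ι : Type*} (l : List ι) (F : ι → ℝ → ℂ) (h : ∀ i ∈ l, LogLaurent (F i)) :
    LogLaurent fun ε => (l.map fun i => F i ε).sum := by
  induction l with
  | nil => simpa using const 0
  | cons i l ih =>
    simp only [List.map_cons, List.sum_cons]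
    exact (h i (by simp)).add (ih fun j hj => h j (by simp [hj]))

theorem eventually_of_punctured {p : ℂ → Prop} (h : ∀ᶠ z in 𝓝[≠] (0 : ℂ), p z) :
    ∀ᶠ ε : ℝ in 𝓝[<] 0, p ε := by
  refine Tendsto.eventually ?_ h
  refine tendsto_nhdsWithin_iff.mpr ⟨?_, ?_⟩
  · exact (Complex.continuous_ofReal.tendsto' 0 0 Complex.ofReal_zero).mono_left
      nhdsWithin_le_nhds
  · filter_upwards [self_mem_nhdsWithin] with ε hε
    simpa using (show ε < 0 from hε).ne

theorem exists_primitive_mul_log_pow (n : ℕ) {a : ℂ → ℂ} (ha : MeromorphicAt a 0) :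
    ∃ G : ℝ → ℂ, LogLaurent G ∧
      ∀ᶠ ε : ℝ in 𝓝[<] 0, HasDerivAt G (a ε * (Real.log (-ε) : ℂ) ^ n) ε := by
  have hlog : ∀ ε : ℝ, ε < 0 → HasDerivAt (fun ε : ℝ => (Real.log (-ε) : ℂ)) (1 / (ε : ℂ)) ε := by
    intro ε hε
    have := ((hasDerivAt_neg ε).log (neg_ne_zero.mpr hε.ne)).ofReal_comp
    convert this using 1
    push_cast
    rw [neg_div_neg_eq]
  induction n generalizing a with
  | zero =>
    obtain ⟨c, F, hF, hd⟩ := ha.exists_primitive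
    refine ⟨fun ε => F ε + c * (Real.log (-ε) : ℂ) ^ 1,
      (of_meromorphicAt hF).add (mul_log_pow (fun _ => c) 1 (MeromorphicAt.const c 0)), ?_⟩
    filter_upwards [eventually_of_punctured hd, self_mem_nhdsWithin] with ε h hε
    refine (h.comp_ofReal.fun_add (((hlog ε hε).fun_pow 1).const_mul c)).congr_deriv ?_
    simp
    ring
  | succ n ih =>
    obtain ⟨c, F, hF, hd⟩ := ha.exists_primitive
    obtain ⟨G, hG, hGd⟩ := ih (a := fun z => -(n + 1) * (F z / z)) (by fun_prop)
    refine ⟨fun ε => (F ε * (Real.log (-ε) : ℂ) ^ (n + 1)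
        + (c / (n + 2)) * (Real.log (-ε) : ℂ) ^ (n + 2)) + G ε,
      ((mul_log_pow F _ hF).add (mul_log_pow (fun _ => c / (n + 2)) _
        (MeromorphicAt.const _ 0))).add hG, ?_⟩
    filter_upwards [eventually_of_punctured hd, hGd, self_mem_nhdsWithin] with ε h hg hε
    refine (((h.comp_ofReal.fun_mul ((hlog ε hε).fun_pow (n + 1))).fun_add
      (((hlog ε hε).fun_pow (n + 2)).const_mul (c / (n + 2)))).fun_add hg).congr_deriv ?_
    have h2 : (n : ℂ) + 2 ≠ 0 := by exact_mod_cast (by omega : n + 2 ≠ 0)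
    have hε0 : (ε : ℂ) ≠ 0 := by exact_mod_cast (show ε < 0 from hε).ne
    simp only [Nat.add_sub_cancel, Nat.cast_add, Nat.cast_one, Nat.cast_ofNat,
      show n + 2 - 1 = n + 1 from rfl]
    field_simp
    ring

theorem exists_primitive (hf : LogLaurent f) :
    ∃ G : ℝ → ℂ, LogLaurent G ∧ ∀ᶠ ε in 𝓝[<] 0, HasDerivAt G (f ε) ε := by
  induction hf with
  | mul_log_pow a n ha => exact exists_primitive_mul_log_pow n ha
  | add _ _ ihf ihg =>
    obtain ⟨F, hF, hFd⟩ := ihf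
    obtain ⟨G, hG, hGd⟩ := ihg
    exact ⟨_, hF.add hG, by filter_upwards [hFd, hGd] with ε h1 h2 using h1.add h2⟩
  | congr _ h ih =>
    obtain ⟨G, hG, hGd⟩ := ih
    exact ⟨G, hG, by filter_upwards [h, hGd] with ε h1 h2 using h1 ▸ h2⟩

theorem of_hasDerivAt (hg : LogLaurent g) (h : ∀ ε < 0, HasDerivAt f (g ε) ε) :
    LogLaurent f := by
  obtain ⟨G, hG, hGd⟩ := hg.exists_primitive
  obtain ⟨δ, hδ, hsub⟩ := mem_nhdsLT_iff_exists_Ioo_subset.mp hGd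
  have hd : ∀ ε ∈ Set.Ioo δ 0, HasDerivAt (fun ε => f ε - G ε) 0 ε := fun ε hε => by
    have := (h ε hε.2).sub (hsub hε)
    rwa [sub_self] at this
  obtain ⟨c, hc⟩ := isOpen_Ioo.exists_is_const_of_deriv_eq_zero isPreconnected_Ioo
    (fun ε hε => (hd ε hε).differentiableAt.differentiableWithinAt) (fun ε hε => (hd ε hε).deriv)
  refine (hG.add (const c)).congr ?_
  filter_upwards [Ioo_mem_nhdsLT hδ] with ε hε
  rw [← hc ε hε]
  ring

theorem exists_coeff (hf : LogLaurent f) :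
    ∃ (M : ℕ) (a : ℕ → ℂ → ℂ), (∀ n, MeromorphicAt (a n) 0) ∧
      ∀ᶠ ε : ℝ in 𝓝[<] 0, ∀ N ≥ M,
        f ε = ∑ n ∈ Finset.range (N + 1), a n ε * (Real.log (-ε) : ℂ) ^ n := by
  induction hf with
  | mul_log_pow a n ha =>
    refine ⟨n, Pi.single n a, fun m => ?_, ?_⟩
    · rcases eq_or_ne m n with rfl | hm
      · simpa using ha
      · rw [Pi.single_eq_of_ne hm]
        exact MeromorphicAt.const (0 : ℂ) 0
    · refine Eventually.of_forall fun ε N hN => ?_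
      rw [Finset.sum_eq_single n]
      · simp
      · intro m _ hm
        simp [hm]
      · intro h
        exact absurd (Finset.mem_range.mpr (by omega)) h
  | add _ _ ihf ihg =>
    obtain ⟨M, a, ha, h⟩ := ihf
    obtain ⟨M', a', ha', h'⟩ := ihg
    refine ⟨max M M', a + a', fun n => (ha n).add (ha' n), ?_⟩
    filter_upwards [h, h'] with ε h h' N hN
    rw [h N (le_of_max_le_left hN), h' N (le_of_max_le_right hN), ← Finset.sum_add_distrib]
    simp only [Pi.add_apply, add_mul]
  | congr _ hfg ih =>
    obtain ⟨M, a, ha, h⟩ := ih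
    refine ⟨M, a, ha, ?_⟩
    filter_upwards [hfg, h] with ε h1 h2 N hN
    rw [← h1, h2 N hN]

end LogLaurent

/-- A pair `(s, r)` encoding the factor `e^{nrε} / n^s` of a directional multiple zeta value. -/
abbrev ZetaLetter := ℤ × {r : ℝ // 0 < r}

namespace ZetaLetter

/-- The factor `e^{nrε} / n^s` at `n = m + 1`. -/
noncomputable def eval (l : ZetaLetter) (ε : ℝ) (m : ℕ) : ℝ :=
  Real.exp (l.2 * ε * (m + 1)) * ((m : ℝ) + 1) ^ (-l.1)

theorem eval_nonneg (l : ZetaLetter) (ε : ℝ) (m : ℕ) : 0 ≤ l.eval ε m := by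
  unfold eval; positivity

theorem eval_add (l l' : ZetaLetter) (ε : ℝ) (m : ℕ) :
    (l + l').eval ε m = l.eval ε m * l'.eval ε m := by
  have hm : (m : ℝ) + 1 ≠ 0 := by positivity
  simp only [eval, Prod.fst_add, Prod.snd_add, Positive.coe_add, neg_add, zpow_add₀ hm, add_mul,
    Real.exp_add]
  ring

theorem eval_le (l : ZetaLetter) {ε η : ℝ} (hε : ε ≤ η) (m : ℕ) :
    l.eval ε m ≤ Real.exp (l.2 * η * (m + 1)) * ((m : ℝ) + 1) ^ l.1.natAbs := by
  have hr := l.2.2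
  have hm : (1 : ℝ) ≤ (m : ℝ) + 1 := by simp
  unfold eval
  gcongr
  rw [← zpow_natCast]
  exact zpow_le_zpow_right₀ hm (by omega)

theorem hasDerivAt_eval (s : ℤ) (r : {r : ℝ // 0 < r}) (ε : ℝ) (m : ℕ) :
    HasDerivAt (fun ε => eval (s, r) ε m) (r * eval (s - 1, r) ε m) ε := by
  have hm : (m : ℝ) + 1 ≠ 0 := by positivity
  refine ((((hasDerivAt_id ε).const_mul (r : ℝ)).mul_const ((m : ℝ) + 1)).exp.mul_const
    (((m : ℝ) + 1) ^ (-s))).congr_deriv ?_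
  simp only [eval, id, sub_eq_add_neg, neg_add, neg_neg, zpow_add₀ hm, zpow_one]
  ring

end ZetaLetter

/-- The nested sum of a word over the tuples `n ≥ n₁ > ⋯ > n_k > 0`. -/
noncomputable def nestedSum : List ZetaLetter → ℝ → ℕ → ℝ
  | [], _, _ => 1
  | l :: w, ε, n => ∑ m ∈ Finset.range n, l.eval ε m * nestedSum w ε m

/-- The nested sum of a word over all tuples `n₁ > ⋯ > n_k > 0`. -/
noncomputable def nestedTsum : List ZetaLetter → ℝ → ℝ
  | [], _ => 1
  | l :: w, ε => ∑' m, l.eval ε m * nestedSum w ε m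

theorem nestedSum_nonneg (w : List ZetaLetter) (ε : ℝ) (n : ℕ) : 0 ≤ nestedSum w ε n := by
  induction w generalizing n with
  | nil => simp [nestedSum]
  | cons l w ih => exact Finset.sum_nonneg fun m _ => mul_nonneg (l.eval_nonneg ε m) (ih m)

theorem nestedSum_mono (w : List ZetaLetter) (ε : ℝ) : Monotone (nestedSum w ε) := by
  cases w with
  | nil => exact monotone_const
  | cons l w =>
    exact fun M N hMN => Finset.sum_le_sum_of_subset_of_nonneg (Finset.range_mono hMN)
      fun m _ _ => mul_nonneg (l.eval_nonneg ε m) (nestedSum_nonneg w ε m)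

theorem exists_nestedSum_le_pow (w : List ZetaLetter) :
    ∃ B : ℕ, ∀ ε ≤ 0, ∀ n, nestedSum w ε n ≤ ((n : ℝ) + 1) ^ B := by
  induction w with
  | nil => exact ⟨0, by simp [nestedSum]⟩
  | cons l w ih =>
    obtain ⟨B, hB⟩ := ih
    refine ⟨l.1.natAbs + B + 1, fun ε hε n => ?_⟩
    have : ∀ m ∈ Finset.range n,
        l.eval ε m * nestedSum w ε m ≤ ((n : ℝ) + 1) ^ (l.1.natAbs + B) := by
      intro m hm
      have hmn : (m : ℝ) ≤ n := by exact_mod_cast (Finset.mem_range.mp hm).le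
      have h1 := l.eval_le hε m
      rw [mul_zero, zero_mul, Real.exp_zero, one_mul] at h1
      rw [pow_add]
      exact mul_le_mul (h1.trans (by gcongr)) ((hB ε hε m).trans (by gcongr))
        (nestedSum_nonneg w ε m) (by positivity)
    refine (Finset.sum_le_card_nsmul _ _ _ this).trans ?_
    rw [Finset.card_range, nsmul_eq_mul, pow_succ' _ (l.1.natAbs + B)]
    gcongr
    simp

theorem exists_summable_bound (l : ZetaLetter) (w : List ZetaLetter) {η : ℝ} (hη : η < 0) :
    ∃ u : ℕ → ℝ, Summable u ∧ ∀ m, ∀ ε ≤ η, ‖l.eval ε m * nestedSum w ε m‖ ≤ u m := by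
  obtain ⟨B, hB⟩ := exists_nestedSum_le_pow w
  have hs := (summable_nat_add_iff 1).mpr (Real.summable_pow_mul_exp_neg_nat_mul (l.1.natAbs + B)
    (mul_pos l.2.2 (neg_pos.mpr hη)))
  refine ⟨_, hs, fun m ε hε => ?_⟩
  rw [Real.norm_of_nonneg (mul_nonneg (l.eval_nonneg ε m) (nestedSum_nonneg w ε m))]
  refine (mul_le_mul (l.eval_le hε m) (hB ε (hε.trans hη.le) m) (nestedSum_nonneg w ε m)
    (by positivity)).trans_eq ?_
  push_cast
  rw [pow_add, show -((l.2 : ℝ) * -η) * ((m : ℝ) + 1) = l.2 * η * (m + 1) by ring]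
  ring

theorem summable_nestedSum (l : ZetaLetter) (w : List ZetaLetter) {ε : ℝ} (hε : ε < 0) :
    Summable fun m => l.eval ε m * nestedSum w ε m := by
  obtain ⟨u, hu, h⟩ := exists_summable_bound l w hε
  exact hu.of_norm_bounded fun m => h m ε le_rfl

theorem tendstoLocallyUniformlyOn_const {α β ι : Type*} [TopologicalSpace α] [UniformSpace β]
    {l : Filter ι} (b : β) (s : Set α) :
    TendstoLocallyUniformlyOn (fun _ _ => b) (fun _ => b) l s :=
  fun _ hu _ _ => ⟨s, self_mem_nhdsWithin, Eventually.of_forall fun _ _ _ =>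
    refl_mem_uniformity hu⟩

theorem tendstoLocallyUniformlyOn_nestedSum (w : List ZetaLetter) :
    TendstoLocallyUniformlyOn (fun n ε => nestedSum w ε n) (nestedTsum w) atTop (Set.Iio 0) := by
  rcases w with _ | ⟨l, w⟩
  · exact tendstoLocallyUniformlyOn_const 1 _
  · intro u hu x hx
    have hx0 : x < 0 := hx
    obtain ⟨b, hb, h⟩ := exists_summable_bound l w (show x / 2 < 0 by linarith)
    exact ⟨Set.Iic (x / 2), mem_nhdsWithin_of_mem_nhds (Iic_mem_nhds (by linarith)),
      tendstoUniformlyOn_tsum_nat hb h u hu⟩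

/-- The words, with coefficients, in the derivative of a nested sum with respect to `ε`. -/
def derivWords : List ZetaLetter → List (ℝ × List ZetaLetter)
  | [] => []
  | (s, r) :: w => ((r : ℝ), (s - 1, r) :: w) :: (derivWords w).map fun p => (p.1, (s, r) :: p.2)

theorem hasDerivAt_nestedSum (w : List ZetaLetter) (ε : ℝ) (n : ℕ) :
    HasDerivAt (fun ε => nestedSum w ε n)
      ((derivWords w).map fun p => p.1 * nestedSum p.2 ε n).sum ε := by
  induction w generalizing n with
  | nil => simpa [nestedSum, derivWords] using hasDerivAt_const ε (1 : ℝ)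
  | cons l w ih =>
    obtain ⟨s, r⟩ := l
    refine (HasDerivAt.fun_sum fun m _ =>
      (ZetaLetter.hasDerivAt_eval s r ε m).fun_mul (ih m)).congr_deriv ?_
    simp only [derivWords, List.map_cons, List.sum_cons, List.map_map, Function.comp_def,
      nestedSum, Finset.sum_add_distrib, Finset.mul_sum, mul_assoc]
    congr 1
    induction derivWords w with
    | nil => simp
    | cons p L ihL =>
      simp only [List.map_cons, List.sum_cons, mul_add, Finset.sum_add_distrib, ihL]
      congr 1
      exact Finset.sum_congr rfl fun m _ => by ring

theorem hasDerivAt_nestedTsum (w : List ZetaLetter) {ε : ℝ} (hε : ε < 0) :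
    HasDerivAt (nestedTsum w) ((derivWords w).map fun p => p.1 * nestedTsum p.2 ε).sum ε := by
  refine hasDerivAt_of_tendstoLocallyUniformlyOn (s := Set.Iio 0) (l := atTop)
    (g' := fun ε => ((derivWords w).map fun p => p.1 * nestedTsum p.2 ε).sum)
    (f' := fun n ε => ((derivWords w).map fun p => p.1 * nestedSum p.2 ε n).sum) isOpen_Iio ?_
    (Eventually.of_forall fun n ε _ => hasDerivAt_nestedSum w ε n)
    (fun ε hε => (tendstoLocallyUniformlyOn_nestedSum w).tendsto_at hε) hε
  induction derivWords w with
  | nil => simpa using tendstoLocallyUniformlyOn_const (0 : ℝ) (Set.Iio 0)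
  | cons p L ih =>
    simp only [List.map_cons, List.sum_cons]
    exact ((uniformContinuous_const_smul p.1).comp_tendstoLocallyUniformlyOn
      (tendstoLocallyUniformlyOn_nestedSum p.2)).add ih

/-- Combinations, with coefficients meromorphic at `0`, of nested sums of words of length less
than `L`, possibly multiplied by a letter. -/
inductive NestedCombination (L : ℕ) : (ℝ → ℕ → ℂ) → Prop
  | zero : NestedCombination L fun _ _ => 0
  | word (c : ℂ → ℂ) (w : List ZetaLetter) : MeromorphicAt c 0 → w.length < L →
      NestedCombination L fun ε n => c ε * nestedSum w ε n
  | eval_mul (c : ℂ → ℂ) (l : ZetaLetter) (w : List ZetaLetter) : MeromorphicAt c 0 →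
      w.length < L → NestedCombination L fun ε n => c ε * (l.eval ε n * nestedSum w ε n)
  | add {F G : ℝ → ℕ → ℂ} : NestedCombination L F → NestedCombination L G →
      NestedCombination L fun ε n => F ε n + G ε n
  | congr {F G : ℝ → ℕ → ℂ} : NestedCombination L F → (∀ ε < 0, ∀ n, F ε n = G ε n) →
      NestedCombination L G

namespace NestedCombination

variable {L : ℕ} {F G : ℝ → ℕ → ℂ}

theorem nestedSum_of_length_lt {w : List ZetaLetter} (hw : w.length < L) :
    NestedCombination L fun ε n => nestedSum w ε n := by
  simpa using word (fun _ => 1) w (MeromorphicAt.const 1 0) hw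

theorem meromorphic_mul {c : ℂ → ℂ} (hc : MeromorphicAt c 0) (hF : NestedCombination L F) :
    NestedCombination L fun ε n => c ε * F ε n := by
  induction hF with
  | zero => simpa using zero
  | word d w hd hw => simpa only [Pi.mul_apply, mul_assoc] using word (c * d) w (hc.mul hd) hw
  | eval_mul d l w hd hw =>
    simpa only [Pi.mul_apply, mul_assoc] using eval_mul (c * d) l w (hc.mul hd) hw
  | add _ _ ihF ihG => simpa only [mul_add] using ihF.add ihG
  | congr _ h ih => exact ih.congr fun ε hε n => by rw [h ε hε n]

theorem sub (hF : NestedCombination L F) (hG : NestedCombination L G) :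
    NestedCombination L fun ε n => F ε n - G ε n := by
  simpa [sub_eq_add_neg] using
    hF.add (hG.meromorphic_mul (c := fun _ => -1) (MeromorphicAt.const _ 0))

theorem finsetSum {ι : Type*} (s : Finset ι) (F : ι → ℝ → ℕ → ℂ)
    (h : ∀ i ∈ s, NestedCombination L (F i)) :
    NestedCombination L fun ε n => ∑ i ∈ s, F i ε n := by
  classical
  induction s using Finset.induction_on with
  | empty => simpa using zero
  | insert i s hi ih =>
    simp only [Finset.sum_insert hi]
    exact (h i (by simp)).add (ih fun j hj => h j (by simp [hj]))

theorem sum_eval_mul (l : ZetaLetter) (hF : NestedCombination L F) :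
    NestedCombination (L + 1) fun ε n => ∑ m ∈ Finset.range n, l.eval ε m * F ε m := by
  induction hF with
  | zero => simpa using zero
  | word c w hc hw =>
    refine (word c (l :: w) hc (by simpa using hw)).congr fun ε _ n => ?_
    simp only [nestedSum, Complex.ofReal_sum, Complex.ofReal_mul, Finset.mul_sum]
    exact Finset.sum_congr rfl fun m _ => by ring
  | eval_mul c l' w hc hw =>
    refine (word c ((l + l') :: w) hc (by simpa using hw)).congr fun ε _ n => ?_
    simp only [nestedSum, ZetaLetter.eval_add, Complex.ofReal_sum, Complex.ofReal_mul,
      Finset.mul_sum]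
    exact Finset.sum_congr rfl fun m _ => by ring
  | add _ _ ihF ihG => simpa only [mul_add, Finset.sum_add_distrib] using ihF.add ihG
  | congr _ h ih =>
    exact ih.congr fun ε hε n => Finset.sum_congr rfl fun m _ => by rw [h ε hε m]

end NestedCombination

theorem ZetaLetter.eval_neg_natCast (a : ℕ) (r : {r : ℝ // 0 < r}) (ε : ℝ) (m : ℕ) :
    eval (-(a : ℤ), r) ε m = Real.exp (r * ε * (m + 1)) * ((m : ℝ) + 1) ^ a := by
  simp [eval]

theorem ZetaLetter.eval_neg_natCast_succ (a : ℕ) (r : {r : ℝ // 0 < r}) (ε : ℝ) (m : ℕ) :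
    eval (-(a : ℤ), r) ε (m + 1) =
      Real.exp (r * ε) * ∑ j ∈ Finset.range (a + 1), a.choose j * eval (-(j : ℤ), r) ε m := by
  simp only [eval_neg_natCast]
  push_cast
  rw [add_pow ((m : ℝ) + 1) 1, show (r : ℝ) * ε * (m + 1 + 1) = r * ε + r * ε * (m + 1) by ring,
    Real.exp_add, mul_assoc, Finset.mul_sum]
  congr 1
  exact Finset.sum_congr rfl fun j _ => by ring

/-- Abel summation. -/
theorem sum_range_sub_mul_add_sum_range_mul_sub {R : Type*} [CommRing R] (g h : ℕ → R) (n : ℕ) :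
    ∑ m ∈ Finset.range n, (g (m + 1) - g m) * h m
      + ∑ m ∈ Finset.range n, g (m + 1) * (h (m + 1) - h m) = g n * h n - g 0 * h 0 := by
  induction n with
  | zero => simp
  | succ n ih =>
    rw [Finset.sum_range_succ, Finset.sum_range_succ]
    linear_combination ih

theorem exp_sub_one_mul_nestedSum (a : ℕ) (r : {r : ℝ // 0 < r}) (w : List ZetaLetter)
    (ε : ℝ) (n : ℕ) :
    (Real.exp (r * ε) - 1) * nestedSum ((-(a : ℤ), r) :: w) ε n =
      ZetaLetter.eval (-(a : ℤ), r) ε n * nestedSum w ε n - Real.exp (r * ε) * nestedSum w ε 0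
      - Real.exp (r * ε) * ∑ j ∈ Finset.range a, a.choose j * nestedSum ((-(j : ℤ), r) :: w) ε n
      - Real.exp (r * ε) * ∑ j ∈ Finset.range (a + 1), a.choose j *
          ∑ m ∈ Finset.range n, ZetaLetter.eval (-(j : ℤ), r) ε m *
            (nestedSum w ε (m + 1) - nestedSum w ε m) := by
  have abel := sum_range_sub_mul_add_sum_range_mul_sub
    (fun m => ZetaLetter.eval (-(a : ℤ), r) ε m) (nestedSum w ε) n
  have h0 : ZetaLetter.eval (-(a : ℤ), r) ε 0 = Real.exp (r * ε) := by
    simp [ZetaLetter.eval_neg_natCast]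
  have hswap : ∀ (N : ℕ) (y : ℕ → ℝ), ∑ m ∈ Finset.range n,
      (∑ j ∈ Finset.range N, (a.choose j : ℝ) * ZetaLetter.eval (-(j : ℤ), r) ε m) * y m =
      ∑ j ∈ Finset.range N, (a.choose j : ℝ) *
        ∑ m ∈ Finset.range n, ZetaLetter.eval (-(j : ℤ), r) ε m * y m := by
    intro N y
    simp only [Finset.sum_mul, Finset.mul_sum]
    rw [Finset.sum_comm]
    exact Finset.sum_congr rfl fun j _ => Finset.sum_congr rfl fun m _ => by ring
  have h1 : ∑ m ∈ Finset.range n, (ZetaLetter.eval (-(a : ℤ), r) ε (m + 1)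
        - ZetaLetter.eval (-(a : ℤ), r) ε m) * nestedSum w ε m =
      (Real.exp (r * ε) - 1) * nestedSum ((-(a : ℤ), r) :: w) ε n + Real.exp (r * ε) *
        ∑ j ∈ Finset.range a, a.choose j * nestedSum ((-(j : ℤ), r) :: w) ε n := by
    simp only [nestedSum]
    rw [← hswap, Finset.mul_sum, Finset.mul_sum, ← Finset.sum_add_distrib]
    refine Finset.sum_congr rfl fun m _ => ?_
    rw [ZetaLetter.eval_neg_natCast_succ, Finset.sum_range_succ, Nat.choose_self, Nat.cast_one]
    ring
  have h2 : ∑ m ∈ Finset.range n, ZetaLetter.eval (-(a : ℤ), r) ε (m + 1) *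
        (nestedSum w ε (m + 1) - nestedSum w ε m) =
      Real.exp (r * ε) * ∑ j ∈ Finset.range (a + 1), a.choose j *
          ∑ m ∈ Finset.range n, ZetaLetter.eval (-(j : ℤ), r) ε m *
            (nestedSum w ε (m + 1) - nestedSum w ε m) := by
    rw [← hswap, Finset.mul_sum]
    refine Finset.sum_congr rfl fun m _ => ?_
    rw [ZetaLetter.eval_neg_natCast_succ]
    ring
  rw [h1, h2, h0] at abel
  linear_combination abel

theorem nestedCombination_cons_neg_natCast (a : ℕ) (r : {r : ℝ // 0 < r}) (w : List ZetaLetter) :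
    NestedCombination (w.length + 1) fun ε n => nestedSum ((-(a : ℤ), r) :: w) ε n := by
  induction a using Nat.strong_induction_on with
  | _ a ih =>
  have hx : MeromorphicAt (fun z : ℂ => Complex.exp (r * z)) 0 :=
    AnalyticAt.meromorphicAt (by fun_prop)
  have hconst : ∀ c : ℂ, MeromorphicAt (fun _ : ℂ => c) 0 := fun c => MeromorphicAt.const c 0
  have h0 : NestedCombination (w.length + 1) fun ε _ => nestedSum w ε 0 := by
    cases w with
    | nil => exact NestedCombination.nestedSum_of_length_lt (w := []) (by simp)
    | cons l w => simpa [nestedSum] using NestedCombination.zero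
  have hdiff : ∀ j : ℕ, NestedCombination (w.length + 1) fun ε n =>
      ((∑ m ∈ Finset.range n, ZetaLetter.eval (-(j : ℤ), r) ε m *
            (nestedSum w ε (m + 1) - nestedSum w ε m) : ℝ) : ℂ) := by
    intro j
    cases w with
    | nil => simpa [nestedSum] using NestedCombination.zero
    | cons l w =>
      refine (NestedCombination.nestedSum_of_length_lt (w := ((-(j : ℤ), r) + l) :: w)
        (by simp)).congr fun ε _ n => ?_
      simp only [nestedSum, Finset.sum_range_succ, add_sub_cancel_left, ZetaLetter.eval_add,
        mul_assoc]
  have hrhs := (((NestedCombination.eval_mul _ (-(a : ℤ), r) w (hconst 1)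
    (Nat.lt_succ_self w.length)).sub (h0.meromorphic_mul hx)).sub
    ((NestedCombination.finsetSum (Finset.range a) _ fun j hj =>
      (ih j (Finset.mem_range.mp hj)).meromorphic_mul (hconst (a.choose j))).meromorphic_mul
        hx)).sub
    ((NestedCombination.finsetSum (Finset.range (a + 1)) _ fun j _ =>
      (hdiff j).meromorphic_mul (hconst (a.choose j))).meromorphic_mul hx)
  refine (hrhs.meromorphic_mul (hx.sub (hconst 1)).inv).congr fun ε hε n => ?_
  have hne : Complex.exp (r * ε) - 1 ≠ 0 := by
    have : Real.exp (r * ε) < 1 := by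
      simpa using mul_neg_of_pos_of_neg r.2 hε
    exact_mod_cast (sub_neg.mpr this).ne
  have key := congrArg (fun t : ℝ => (t : ℂ)) (exp_sub_one_mul_nestedSum a r w ε n)
  push_cast at key
  simp only [Pi.inv_apply, Pi.sub_apply]
  rw [inv_mul_eq_iff_eq_mul₀ hne, key]
  push_cast
  ring

theorem nestedCombination_of_exists_nonpos (w : List ZetaLetter) (hw : ∃ l ∈ w, l.1 ≤ 0) :
    NestedCombination w.length fun ε n => nestedSum w ε n := by
  induction w with
  | nil => simp at hw
  | cons l w ih =>
    by_cases hl : l.1 ≤ 0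
    · obtain ⟨s, r⟩ := l
      obtain ⟨a, rfl⟩ : ∃ a : ℕ, s = -(a : ℤ) := ⟨(-s).toNat, by simp at hl; omega⟩
      exact nestedCombination_cons_neg_natCast a r w
    · obtain ⟨l', hl', hs⟩ := hw
      have hmem : l' ∈ w := (List.mem_cons.mp hl').resolve_left fun h => hl (h ▸ hs)
      refine ((ih ⟨l', hmem, hs⟩).sum_eval_mul l).congr fun ε _ n => ?_
      simp [nestedSum]

theorem NestedCombination.exists_tendsto {L : ℕ} {F : ℝ → ℕ → ℂ} (hF : NestedCombination L F)
    (hL : ∀ w : List ZetaLetter, w.length < L → LogLaurent fun ε => nestedTsum w ε) :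
    ∃ g, LogLaurent g ∧ ∀ ε < 0, Tendsto (F ε) atTop (𝓝 (g ε)) := by
  induction hF with
  | zero => exact ⟨_, LogLaurent.const 0, fun _ _ => tendsto_const_nhds⟩
  | word c w hc hw =>
    refine ⟨_, (hL w hw).meromorphic_mul hc, fun ε hε => Tendsto.const_mul _ ?_⟩
    exact ((Complex.continuous_ofReal.tendsto _).comp
      ((tendstoLocallyUniformlyOn_nestedSum w).tendsto_at hε))
  | eval_mul c l w hc hw =>
    refine ⟨_, LogLaurent.const 0, fun ε hε => ?_⟩
    have := (Complex.continuous_ofReal.tendsto _).comp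
      (summable_nestedSum l w hε).tendsto_atTop_zero
    simpa [Function.comp_def] using this.const_mul (c ε)
  | add _ _ ihF ihG =>
    obtain ⟨f, hf, hft⟩ := ihF
    obtain ⟨g, hg, hgt⟩ := ihG
    exact ⟨_, hf.add hg, fun ε hε => (hft ε hε).add (hgt ε hε)⟩
  | congr _ h ih =>
    obtain ⟨g, hg, hgt⟩ := ih
    exact ⟨g, hg, fun ε hε => (hgt ε hε).congr (h ε hε)⟩

/-- The total positive weight of a word. -/
def wordWeight (w : List ZetaLetter) : ℕ := (w.map fun l => l.1.toNat).sum

theorem length_eq_and_wordWeight_lt_of_mem_derivWords {w : List ZetaLetter}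
    (hw : ∀ l ∈ w, 0 < l.1) {p : ℝ × List ZetaLetter} (hp : p ∈ derivWords w) :
    p.2.length = w.length ∧ wordWeight p.2 < wordWeight w := by
  induction w generalizing p with
  | nil => simp [derivWords] at hp
  | cons l w ih =>
    obtain ⟨s, r⟩ := l
    have hs : 0 < s := hw (s, r) (by simp)
    simp only [derivWords, List.mem_cons, List.mem_map] at hp
    rcases hp with rfl | ⟨q, hq, rfl⟩
    · simp [wordWeight]
      omega
    · have := ih (fun l hl => hw l (by simp [hl])) hq
      simp only [wordWeight, List.map_cons, List.sum_cons, List.length_cons] at this ⊢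
      omega

theorem logLaurent_nestedTsum (w : List ZetaLetter) : LogLaurent fun ε => nestedTsum w ε := by
  induction hk : w.length using Nat.strong_induction_on generalizing w with
  | _ k ihk =>
  induction hμ : wordWeight w using Nat.strong_induction_on generalizing w with
  | _ μ ihμ =>
  by_cases hw : ∃ l ∈ w, l.1 ≤ 0
  · obtain ⟨g, hg, hgt⟩ := (nestedCombination_of_exists_nonpos w hw).exists_tendsto
      fun w' hw' => ihk _ (hk ▸ hw') w' rfl
    refine hg.congr ?_
    filter_upwards [self_mem_nhdsWithin] with ε hε
    exact tendsto_nhds_unique (hgt ε hε) ((Complex.continuous_ofReal.tendsto _).comp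
      ((tendstoLocallyUniformlyOn_nestedSum w).tendsto_at hε))
  · push Not at hw
    have hd : LogLaurent fun ε =>
        ((derivWords w).map fun p => (p.1 : ℂ) * (nestedTsum p.2 ε : ℂ)).sum := by
      refine LogLaurent.listSum (derivWords w)
        (fun p ε => (p.1 : ℂ) * (nestedTsum p.2 ε : ℂ)) fun p hp => ?_
      obtain ⟨h1, h2⟩ := length_eq_and_wordWeight_lt_of_mem_derivWords hw hp
      exact LogLaurent.meromorphic_mul (c := fun _ => (p.1 : ℂ)) (MeromorphicAt.const _ 0)
        (ihμ _ (hμ ▸ h2) p.2 (h1.trans hk) rfl)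
    refine hd.of_hasDerivAt fun ε hε => ?_
    refine (hasDerivAt_nestedTsum w hε).ofReal_comp.congr_deriv ?_
    induction derivWords w with
    | nil => simp
    | cons p l ih => simp [ih]

/-- The strictly decreasing `k`-tuples `N ≥ n₁ > ⋯ > n_k > 0`. -/
def decTuples (k N : ℕ) : Finset (Fin k → ℕ) :=
  {n ∈ Fintype.piFinset fun _ => Finset.range (N + 1) | StrictAnti n ∧ ∀ i, 0 < n i}

theorem mem_decTuples {k N : ℕ} {n : Fin k → ℕ} :
    n ∈ decTuples k N ↔ (∀ i, n i ≤ N) ∧ StrictAnti n ∧ ∀ i, 0 < n i := by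
  simp [decTuples]

theorem strictAnti_cons {k a : ℕ} {t : Fin k → ℕ} :
    StrictAnti (Fin.cons a t : Fin (k + 1) → ℕ) ↔ (∀ i, t i < a) ∧ StrictAnti t := by
  refine ⟨fun h => ⟨fun i => ?_, fun i j hij => ?_⟩, fun h i j hij => ?_⟩
  · simpa using h (Fin.succ_pos i)
  · simpa using h (Fin.succ_lt_succ_iff.mpr hij)
  · cases j using Fin.cases with
    | zero => exact absurd hij (Fin.not_lt_zero i)
    | succ j =>
      cases i using Fin.cases with
      | zero => simpa using h.1 j
      | succ i => simpa using h.2 (Fin.succ_lt_succ_iff.mp hij)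

theorem cons_mem_decTuples {k N m : ℕ} {t : Fin k → ℕ} :
    (Fin.cons (m + 1) t : Fin (k + 1) → ℕ) ∈ decTuples (k + 1) N ↔
      m < N ∧ t ∈ decTuples k m := by
  simp only [mem_decTuples, strictAnti_cons, Fin.forall_fin_succ, Fin.cons_zero, Fin.cons_succ,
    Nat.lt_succ_iff, Nat.succ_le_iff, Nat.zero_le, true_and]
  constructor
  · rintro ⟨⟨h1, -⟩, ⟨h2, h3⟩, h4⟩
    exact ⟨h1, h2, h3, h4⟩
  · rintro ⟨h1, h2, h3, h4⟩
    exact ⟨⟨h1, fun i => (h2 i).trans h1.le⟩, ⟨h2, h3⟩, h4⟩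

theorem sum_decTuples {k : ℕ} (l : Fin k → ZetaLetter) (ε : ℝ) (N : ℕ) :
    ∑ n ∈ decTuples k N, ∏ i, (l i).eval ε (n i - 1) = nestedSum (List.ofFn l) ε N := by
  induction k generalizing N with
  | zero =>
    have : decTuples 0 N = {Fin.elim0} := by
      ext n
      simp [mem_decTuples, Subsingleton.elim n Fin.elim0, StrictAnti]
    simp [this, nestedSum]
  | succ k ih =>
    rw [List.ofFn_succ, nestedSum]
    simp only [← ih, Finset.mul_sum]
    rw [Finset.sum_sigma']
    symm
    refine Finset.sum_bij' (fun p _ => Fin.cons (p.1 + 1) p.2) (fun n _ => ⟨n 0 - 1, Fin.tail n⟩)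
      ?_ ?_ ?_ ?_ ?_
    · rintro ⟨m, t⟩ h
      simpa [cons_mem_decTuples] using h
    · intro n hn
      have h0 : n 0 - 1 + 1 = n 0 := Nat.sub_add_cancel ((mem_decTuples.mp hn).2.2 0)
      rw [← Fin.cons_self_tail n, ← h0, cons_mem_decTuples] at hn
      simpa using hn
    · rintro ⟨m, t⟩ h
      simp
    · intro n hn
      have h0 : n 0 - 1 + 1 = n 0 := Nat.sub_add_cancel ((mem_decTuples.mp hn).2.2 0)
      simp [h0]
    · rintro ⟨m, t⟩ h
      simp [Fin.prod_univ_succ]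

theorem hasSum_decTuples {k : ℕ} (l : Fin k → ZetaLetter) {ε : ℝ} (hε : ε < 0) :
    HasSum (fun n : {n : Fin k → ℕ // StrictAnti n ∧ ∀ i, 0 < n i} =>
      ∏ i, (l i).eval ε (n.1 i - 1)) (nestedTsum (List.ofFn l) ε) := by
  let T : ℕ → Finset ({n : Fin k → ℕ // StrictAnti n ∧ ∀ i, 0 < n i}) := fun N =>
    (decTuples k N).subtype fun n => StrictAnti n ∧ ∀ i, 0 < n i
  have hT : ∀ N, ∑ n ∈ T N, ∏ i, (l i).eval ε (n.1 i - 1) = nestedSum (List.ofFn l) ε N := by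
    intro N
    have h := Finset.sum_subtype_of_mem (s := decTuples k N)
      (p := fun n : Fin k → ℕ => StrictAnti n ∧ ∀ i, 0 < n i)
      (fun n : Fin k → ℕ => ∏ i, (l i).eval ε (n i - 1)) fun n hn => (mem_decTuples.mp hn).2
    rw [← sum_decTuples, ← h]
  have hlim := (tendstoLocallyUniformlyOn_nestedSum (List.ofFn l)).tendsto_at hε
  have hTlim : Tendsto T atTop atTop := by
    refine tendsto_atTop_finset_of_monotone ?_ ?_
    · intro M N hMN n hn
      simp only [T, Finset.mem_subtype, mem_decTuples] at hn ⊢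
      exact ⟨fun i => (hn.1 i).trans hMN, hn.2⟩
    · intro n
      refine ⟨∑ i, n.1 i, ?_⟩
      simp only [T, Finset.mem_subtype, mem_decTuples]
      exact ⟨fun i => Finset.single_le_sum (fun _ _ => Nat.zero_le _) (Finset.mem_univ i), n.2⟩
  have hnn : ∀ n : {n : Fin k → ℕ // StrictAnti n ∧ ∀ i, 0 < n i},
      0 ≤ ∏ i, (l i).eval ε (n.1 i - 1) := fun n =>
    Finset.prod_nonneg fun i _ => (l i).eval_nonneg ε _
  have hsum : Summable fun n : {n : Fin k → ℕ // StrictAnti n ∧ ∀ i, 0 < n i} =>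
      ∏ i, (l i).eval ε (n.1 i - 1) := by
    refine summable_of_sum_le hnn (c := nestedTsum (List.ofFn l) ε) fun u => ?_
    obtain ⟨N, hN⟩ := (hTlim.eventually_ge_atTop u).exists
    exact ((Finset.sum_le_sum_of_subset_of_nonneg hN fun n _ _ => hnn n).trans_eq (hT N)).trans
      ((nestedSum_mono _ ε).ge_of_tendsto hlim N)
  have := hsum.hasSum.comp hTlim
  simp only [Function.comp_def, hT] at this
  exact tendsto_nhds_unique hlim this ▸ hsum.hasSum

theorem Zreg_eq_nestedTsum {k : ℕ} (s : Fin k → ℤ) (r : Fin k → {r : ℝ // 0 < r}) {ε : ℝ}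
    (hε : ε < 0) :
    Zreg k s (fun i => r i) ε = nestedTsum (List.ofFn fun i => (s i, r i)) ε := by
  rw [← (Complex.hasSum_ofReal.mpr (hasSum_decTuples (fun i => (s i, r i)) hε)).tsum_eq, Zreg]
  refine tsum_congr fun n => ?_
  push_cast
  refine Finset.prod_congr rfl fun i _ => ?_
  have hn : ((n.1 i - 1 : ℕ) : ℝ) + 1 = n.1 i := by
    exact_mod_cast Nat.sub_add_cancel (n.2.2 i)
  rw [ZetaLetter.eval, hn]
  push_cast
  rw [zpow_neg, div_eq_mul_inv]
  congr 2
  ring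

/-- For any `s ∈ ℤ^k` and `r ∈ ℤ_{>0}^k`, the directional regularized MZV `Z(s, r; ε)`,
restricted to real `ε < 0`, is a log-Laurent function near `0`. -/
theorem Zreg_is_logLaurent (k : ℕ) (hk : 1 ≤ k) (s : Fin k → ℤ) (r : Fin k → ℤ)
    (hr : ∀ i, 0 < r i) :
    ∃ (δ : ℝ) (M : ℕ) (a : ℕ → ℂ → ℂ), 0 < δ ∧ (∀ n ≤ M, MeromorphicAt (a n) 0) ∧
      ∀ ε : ℝ, ε ∈ Set.Ioo (-δ) 0 →
        Zreg k s (fun i => (r i : ℝ)) (ε : ℂ)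
          = ∑ n ∈ Finset.range (M + 1), a n (ε : ℂ) * ((Real.log (-ε) : ℂ)) ^ n := by
  let r' : Fin k → {r : ℝ // 0 < r} := fun i => ⟨r i, Int.cast_pos.mpr (hr i)⟩
  obtain ⟨M, a, ha, h⟩ := (logLaurent_nestedTsum (List.ofFn fun i => (s i, r' i))).exists_coeff
  obtain ⟨δ, hδ, hsub⟩ := mem_nhdsLT_iff_exists_Ioo_subset.mp h
  refine ⟨-δ, M, a, neg_pos.mpr hδ, fun n _ => ha n, fun ε hε => ?_⟩
  rw [neg_neg] at hε
  exact (Zreg_eq_nestedTsum s r' hε.2).trans (hsub hε M le_rfl)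
end

section
/- Let k ≥ 1, s = (s_1, …, s_k) ∈ ℤ^k with s_i ≤ 0 for all i, and r = (r_1, …, r_k) ∈ ℤ_{>0}^k. Then Z(s, r; ε) is meromorphic at 0: there exist δ > 0 and a function g holomorphic on the punctured disc {0 < |ε| < δ} with at worst a pole at 0, such that Z(s, r; ε) = g(ε) for all ε with 0 < |ε| < δ and Re(ε) < 0. -/
/-- The `n`-tuple with prescribed gaps: `nᵢ = ∑_{j ≥ i} (mⱼ + 1)`. -/
def DecSeq.ofGaps {k : ℕ} (m : Fin k → ℕ) : DecSeq k :=
  ⟨fun i => ∑ j ∈ Finset.Ici i, (m j + 1), by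
    refine ⟨fun a b hab => ?_, fun i => ?_⟩
    · refine Finset.sum_lt_sum_of_subset (Finset.Ici_subset_Ici.2 hab.le) (i := a)
        (by simp) (by simpa using hab) (by simp) (by simp)
    · exact Finset.sum_pos (by simp) ⟨i, by simp⟩⟩

theorem DecSeq.ofGaps_injective {k : ℕ} : Function.Injective (DecSeq.ofGaps (k := k)) := by
  intro m m' h
  have hsum : ∀ i, ∑ j ∈ Finset.Ici i, (m j + 1) = ∑ j ∈ Finset.Ici i, (m' j + 1) := fun i =>
    congrFun (congrArg Subtype.val h) i
  funext i
  induction i using WellFoundedGT.induction with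
  | ind i ih =>
    have hi := hsum i
    rw [← Finset.Ioi_insert, Finset.sum_insert (by simp), Finset.sum_insert (by simp)] at hi
    have : ∑ j ∈ Finset.Ioi i, (m j + 1) = ∑ j ∈ Finset.Ioi i, (m' j + 1) :=
      Finset.sum_congr rfl fun j hj => by rw [ih j (Finset.mem_Ioi.1 hj)]
    omega

theorem DecSeq.ofGaps_surjective {k : ℕ} : Function.Surjective (DecSeq.ofGaps (k := k)) := by
  rintro ⟨n, hn, hpos⟩
  refine ⟨fun i => n i - (if h : (i : ℕ) + 1 < k then n ⟨i + 1, h⟩ else 0) - 1,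
    Subtype.ext (funext fun i => ?_)⟩
  simp only [DecSeq.ofGaps]
  induction i using WellFoundedGT.induction with
  | ind i ih =>
    rw [← Finset.Ioi_insert, Finset.sum_insert (by simp)]
    by_cases h : (i : ℕ) + 1 < k
    · have hIoi : Finset.Ioi i = Finset.Ici (⟨i + 1, h⟩ : Fin k) := by
        ext j
        simp only [Finset.mem_Ioi, Finset.mem_Ici, Fin.lt_def, Fin.le_def]
        omega
      have hlt : i < (⟨i + 1, h⟩ : Fin k) := by simp [Fin.lt_def]
      rw [hIoi, ih _ hlt, dif_pos h]
      have := hn hlt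
      omega
    · have hIoi : Finset.Ioi i = ∅ := by
        ext j
        simp only [Finset.mem_Ioi, Fin.lt_def, Finset.notMem_empty, iff_false]
        omega
      rw [hIoi, dif_neg h]
      have := hpos i
      simp only [Finset.sum_empty]
      omega

/-- Fubini for finite products of absolutely convergent series. -/
theorem summable_norm_prod_and_tsum_prod {R : Type*} [NormedField R] [CompleteSpace R] {ι : Type*}
    {k : ℕ} (f : Fin k → ι → R) (hf : ∀ i, Summable fun m => ‖f i m‖) :
    (Summable fun m : Fin k → ι => ‖∏ i, f i (m i)‖) ∧
      ∑' m : Fin k → ι, ∏ i, f i (m i) = ∏ i, ∑' m, f i m := by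
  induction k with
  | zero => exact ⟨Summable.of_finite, by simp⟩
  | succ k ih =>
    obtain ⟨hs, ht⟩ := ih (fun i => f i.succ) fun i => hf i.succ
    let e := Fin.consEquiv fun _ : Fin (k + 1) => ι
    have he : ∀ p : ι × (Fin k → ι),
        ∏ i, f i (e p i) = f 0 p.1 * ∏ i : Fin k, f i.succ (p.2 i) := fun p => by
      simp [e, Fin.consEquiv, Fin.prod_univ_succ]
    constructor
    · rw [← e.summable_iff]
      refine ((hf 0).mul_norm hs).congr fun p => ?_
      simp only [Function.comp_apply, he]
    · rw [← e.tsum_eq, Fin.prod_univ_succ, ← ht,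
        tsum_mul_tsum_of_summable_norm (hf 0) hs]
      exact tsum_congr he

theorem one_sub_mul_tsum_pow_mul_geometric (a : ℕ) {q : ℂ} (hq : ‖q‖ < 1) :
    (1 - q) * ∑' m : ℕ, (m : ℂ) ^ a * q ^ m =
      0 ^ a + q * ∑ j : Fin a, (a.choose j : ℂ) * ∑' m : ℕ, (m : ℂ) ^ (j : ℕ) * q ^ m := by
  have hS : ∀ b : ℕ, Summable fun m : ℕ => (m : ℂ) ^ b * q ^ m := fun b =>
    summable_pow_mul_geometric_of_norm_lt_one b hq
  have hshift : ∑' m : ℕ, ((m + 1 : ℕ) : ℂ) ^ a * q ^ (m + 1) =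
      q * ∑ j ∈ Finset.range (a + 1), (a.choose j : ℂ) * ∑' m : ℕ, (m : ℂ) ^ j * q ^ m := by
    simp_rw [← tsum_mul_left]
    rw [← Summable.tsum_finsetSum fun j _ => (hS j).mul_left _, ← tsum_mul_left]
    refine tsum_congr fun m => ?_
    push_cast
    rw [add_pow, Finset.sum_mul, Finset.mul_sum]
    refine Finset.sum_congr rfl fun j _ => ?_
    ring
  have h0 := (hS a).tsum_eq_zero_add
  rw [hshift, Finset.sum_range_succ, Finset.sum_range] at h0
  simp only [Nat.choose_self, Nat.cast_one, one_mul, Nat.cast_zero, pow_zero, mul_one] at h0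
  linear_combination h0

/-- The power series `∑ mᵃ qᵐ` extends to `ℂ \ {1}` and is meromorphic at `1`. -/
theorem exists_extension_tsum_pow_mul_geometric (a : ℕ) :
    ∃ G : ℂ → ℂ, (∀ q, q ≠ 1 → DifferentiableAt ℂ G q) ∧ MeromorphicAt G 1 ∧
      ∀ q : ℂ, ‖q‖ < 1 → ∑' m : ℕ, (m : ℂ) ^ a * q ^ m = G q := by
  induction a using Nat.strong_induction_on with
  | _ a ih =>
    choose G hd hm hG using fun j : Fin a => ih j j.2
    refine ⟨fun q => (0 ^ a + q * ∑ j : Fin a, (a.choose j : ℂ) * G j q) / (1 - q),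
      fun q hq => ?_, ?_, fun q hq => ?_⟩
    · have h1 : 1 - q ≠ 0 := sub_ne_zero.2 hq.symm
      have hsum : DifferentiableAt ℂ (fun q => ∑ j : Fin a, (a.choose j : ℂ) * G j q) q :=
        DifferentiableAt.fun_sum fun j _ => (hd j q hq).const_mul _
      fun_prop (disch := assumption)
    · have hsum : MeromorphicAt (fun q => ∑ j : Fin a, (a.choose j : ℂ) * G j q) 1 :=
        MeromorphicAt.fun_sum fun j _ => (MeromorphicAt.const _ _).mul (hm j)
      exact ((MeromorphicAt.const _ _).add ((MeromorphicAt.id _).mul hsum)).div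
        ((MeromorphicAt.const _ _).sub (MeromorphicAt.id _))
    · have h1 : 1 - q ≠ 0 := sub_ne_zero.2 fun h => by simp [← h] at hq
      rw [eq_div_iff h1, mul_comm, one_sub_mul_tsum_pow_mul_geometric a hq]
      simp only [hG _ q hq]

/-- Sums of a polynomial times a product of geometric sequences reduce to one-variable sums. -/
theorem tsum_eval_mul_prod_pow {k : ℕ} (P : MvPolynomial (Fin k) ℂ) (q : Fin k → ℂ)
    (hq : ∀ j, ‖q j‖ < 1) :
    ∑' m : Fin k → ℕ, MvPolynomial.eval (fun j => (m j : ℂ)) P * ∏ j, q j ^ m j =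
      ∑ d ∈ P.support, P.coeff d * ∏ j, ∑' m : ℕ, (m : ℂ) ^ d j * q j ^ m := by
  have key := fun d : Fin k →₀ ℕ => summable_norm_prod_and_tsum_prod
    (fun j (m : ℕ) => (m : ℂ) ^ d j * q j ^ m)
    fun j => summable_norm_pow_mul_geometric_of_norm_lt_one (d j) (hq j)
  simp_rw [← fun d => (key d).2, ← tsum_mul_left]
  rw [← Summable.tsum_finsetSum fun d _ => (key d).1.of_norm.mul_left _]
  refine tsum_congr fun m => ?_
  rw [MvPolynomial.eval_eq', Finset.sum_mul]
  refine Finset.sum_congr rfl fun d _ => ?_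
  rw [Finset.prod_mul_distrib, mul_assoc]

/-- The summand of `Zreg` as a polynomial in the gaps times a product of geometric sequences. -/
theorem prod_exp_div_zpow_ofGaps {k : ℕ} (t : Fin k → ℕ) (r : Fin k → ℝ) (ε : ℂ)
    (m : Fin k → ℕ) :
    ∏ i, Complex.exp (((DecSeq.ofGaps m).1 i : ℂ) * (r i : ℂ) * ε) /
        (((DecSeq.ofGaps m).1 i : ℂ) ^ (-(t i : ℤ))) =
      (∏ j, Complex.exp (((∑ i ∈ Finset.Iic j, r i : ℝ) : ℂ) * ε)) *
        (MvPolynomial.eval (fun j => (m j : ℂ))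
            (∏ i, (∑ j ∈ Finset.Ici i, (MvPolynomial.X j + 1)) ^ t i) *
          ∏ j, Complex.exp (((∑ i ∈ Finset.Iic j, r i : ℝ) : ℂ) * ε) ^ m j) := by
  have hpoly : MvPolynomial.eval (fun j => (m j : ℂ))
      (∏ i, (∑ j ∈ Finset.Ici i, (MvPolynomial.X j + 1)) ^ t i) =
      ∏ i, ((DecSeq.ofGaps m).1 i : ℂ) ^ t i := by
    simp [DecSeq.ofGaps, map_prod, map_sum]
  have hexp : ∏ i, Complex.exp (((DecSeq.ofGaps m).1 i : ℂ) * (r i : ℂ) * ε) =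
      (∏ j, Complex.exp (((∑ i ∈ Finset.Iic j, r i : ℝ) : ℂ) * ε)) *
        ∏ j, Complex.exp (((∑ i ∈ Finset.Iic j, r i : ℝ) : ℂ) * ε) ^ m j := by
    rw [← Finset.prod_mul_distrib]
    simp_rw [← pow_succ', ← Complex.exp_nat_mul, ← Complex.exp_sum]
    congr 1
    simp only [DecSeq.ofGaps, Nat.cast_sum, Complex.ofReal_sum, Finset.sum_mul, Finset.mul_sum]
    rw [Finset.sum_comm' (t' := Finset.univ) (s' := fun j => Finset.Iic j) (by simp)]
    simp_rw [mul_assoc]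
  simp_rw [zpow_neg, div_inv_eq_mul, zpow_natCast]
  rw [Finset.prod_mul_distrib, hpoly, hexp]
  ring

theorem exp_mul_ne_one_of_norm_lt {R : ℝ} (hR : R ≠ 0) {ε : ℂ} (hε : ε ≠ 0)
    (h : ‖(R : ℂ) * ε‖ < 1) : Complex.exp (R * ε) ≠ 1 := by
  intro he
  obtain ⟨n, hn⟩ := Complex.exp_eq_one_iff.1 he
  have hn0 : n ≠ 0 := by
    rintro rfl
    simp [hR, hε] at hn
  have h1 : (1 : ℝ) ≤ |(n : ℝ)| := by exact_mod_cast Int.one_le_abs hn0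
  rw [hn] at h
  simp only [norm_mul, Complex.norm_intCast, Complex.norm_ofNat, Complex.norm_real,
    Complex.norm_I, mul_one, Real.norm_eq_abs, abs_of_pos Real.pi_pos] at h
  nlinarith [Real.pi_gt_three]

/-- If all `sᵢ ≤ 0`, then `Z(s, r; ε)` is meromorphic at `0`: it agrees, on the part of a
punctured disc with `Re ε < 0`, with a function holomorphic on that punctured disc having at
worst a pole at `0`. -/
theorem Zreg_meromorphic_of_nonpositive (k : ℕ) (hk : 1 ≤ k) (s : Fin k → ℤ)
    (hs : ∀ i, s i ≤ 0) (r : Fin k → ℤ) (hr : ∀ i, 0 < r i) :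
    ∃ (δ : ℝ) (g : ℂ → ℂ), 0 < δ ∧
      DifferentiableOn ℂ g (Metric.ball (0 : ℂ) δ \ {0}) ∧
      MeromorphicAt g 0 ∧
      ∀ ε : ℂ, ε ∈ Metric.ball (0 : ℂ) δ \ {0} → ε.re < 0 →
        Zreg k s (fun i => (r i : ℝ)) ε = g ε := by
  have hst : ∀ i, s i = -((-s i).toNat : ℤ) := fun i => by have := hs i; omega
  generalize ht : (fun i => (-s i).toNat) = t
  obtain rfl : s = fun i => -(t i : ℤ) := by subst ht; exact funext hst
  have hr' : ∀ i, (0 : ℝ) < r i := fun i => by exact_mod_cast hr i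
  let R : Fin k → ℝ := fun j => ∑ i ∈ Finset.Iic j, (r i : ℝ)
  let T : ℝ := ∑ i, (r i : ℝ)
  have hR : ∀ j, 0 < R j := fun j => Finset.sum_pos (fun i _ => hr' i) ⟨j, by simp⟩
  have hRT : ∀ j, R j ≤ T := fun j =>
    Finset.sum_le_sum_of_subset_of_nonneg (Finset.subset_univ _) fun i _ _ => (hr' i).le
  have hT : 0 < T := (hR ⟨0, hk⟩).trans_le (hRT _)
  choose G hd hm hG using exists_extension_tsum_pow_mul_geometric
  let P : MvPolynomial (Fin k) ℂ := ∏ i, (∑ j ∈ Finset.Ici i, (MvPolynomial.X j + 1)) ^ t i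
  refine ⟨T⁻¹, fun ε => (∏ j, Complex.exp (R j * ε)) *
    ∑ d ∈ P.support, P.coeff d * ∏ j, G (d j) (Complex.exp (R j * ε)), inv_pos.2 hT,
    fun ε hε => DifferentiableAt.differentiableWithinAt ?_, ?_, fun ε hε hre => ?_⟩
  · have hne : ∀ j, Complex.exp (R j * ε) ≠ 1 := fun j => by
      refine exp_mul_ne_one_of_norm_lt (hR j).ne' hε.2 ?_
      have hlt : ‖ε‖ < T⁻¹ := by simpa using hε.1
      rw [norm_mul, Complex.norm_real, Real.norm_of_nonneg (hR j).le]
      calc R j * ‖ε‖ ≤ T * ‖ε‖ := by gcongr; exact hRT j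
        _ < T * T⁻¹ := by gcongr
        _ = 1 := mul_inv_cancel₀ hT.ne'
    refine DifferentiableAt.mul (DifferentiableAt.fun_finsetProd fun j _ => by fun_prop)
      (DifferentiableAt.fun_sum fun d _ => DifferentiableAt.const_mul
        (DifferentiableAt.fun_finsetProd fun j _ => ?_) _)
    exact (hd (d j) _ (hne j)).comp ε (f := fun ε => Complex.exp (R j * ε)) (by fun_prop)
  · have han : ∀ j, AnalyticAt ℂ (fun ε => Complex.exp (R j * ε)) 0 := fun j => by fun_prop
    refine MeromorphicAt.mul (MeromorphicAt.fun_prod fun j _ => (han j).meromorphicAt)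
      (MeromorphicAt.fun_sum fun d _ => (MeromorphicAt.const _ _).mul
        (MeromorphicAt.fun_prod fun j _ => ?_))
    exact MeromorphicAt.comp_analyticAt (f := G (d j)) (by simpa using hm (d j)) (han j)
  · have hq : ∀ j, ‖Complex.exp (R j * ε)‖ < 1 := fun j => by
      rw [Complex.norm_exp, Real.exp_lt_one_iff, Complex.re_ofReal_mul]
      exact mul_neg_of_pos_of_neg (hR j) hre
    have hbij : Function.Bijective (DecSeq.ofGaps (k := k)) :=
      ⟨DecSeq.ofGaps_injective, DecSeq.ofGaps_surjective⟩
    rw [Zreg, ← (Equiv.ofBijective _ hbij).tsum_eq]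
    refine (tsum_congr fun m =>
      prod_exp_div_zpow_ofGaps t (fun i => (r i : ℝ)) ε m).trans ?_
    rw [tsum_mul_left, tsum_eval_mul_prod_pow P _ hq]
    simp only [hG _ _ (hq _)]
    rfl
end

section
/- For every complex ε with Re(ε) < 0 one has ∑_{n=1}^∞ e^{nε} = e^ε/(1 − e^ε). Moreover the function g(ε) = e^ε/(1 − e^ε) + 1/ε, holomorphic on the punctured disc {0 < |ε| < 2π}, extends holomorphically to ε = 0, and its Taylor expansion at 0 is g(ε) = ∑_{i=0}^∞ ζ(−i)·ε^i/i!, where ζ denotes the Riemann zeta function (so ζ(0) = −1/2 and ζ(−i) = (−1)^i B_{i+1}/(i+1) in terms of Bernoulli numbers). -/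
open Complex

lemma exp_sub_one_eq_mul_dslope (z : ℂ) : exp z - 1 = z * dslope exp 0 z := by
  simpa using (sub_smul_dslope exp 0 z).symm

lemma dslope_exp_zero_ne_zero {z : ℂ} (hz : z ∈ Metric.ball (0 : ℂ) (2 * Real.pi)) :
    dslope exp 0 z ≠ 0 := by
  intro h
  have h1 : exp z = 1 := by
    have := exp_sub_one_eq_mul_dslope z
    rw [h, mul_zero] at this
    exact sub_eq_zero.mp this
  obtain ⟨n, rfl⟩ := exp_eq_one_iff.mp h1
  have hn : n = 0 := by
    by_contra hn
    have h2 : (1 : ℝ) ≤ |(n : ℝ)| := by exact_mod_cast Int.one_le_abs hn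
    rw [mem_ball_zero_iff] at hz
    simp only [norm_mul, norm_intCast, norm_ofNat, norm_real, Real.norm_eq_abs,
      abs_of_pos Real.pi_pos, norm_I, mul_one] at hz
    nlinarith [Real.pi_pos]
  subst hn
  simp [dslope_same] at h

/-- The function `z * exp z / (exp z - 1)`, with its removable singularity at `0` removed: the
exponential generating function of the Bernoulli numbers `bernoulli'`. -/
noncomputable def bernoulliGenFun (z : ℂ) : ℂ := exp z / dslope exp 0 z

lemma bernoulliGenFun_zero : bernoulliGenFun 0 = 1 := by
  simp [bernoulliGenFun, dslope_same]

lemma differentiableOn_bernoulliGenFun :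
    DifferentiableOn ℂ bernoulliGenFun (Metric.ball 0 (2 * Real.pi)) := by
  refine differentiable_exp.differentiableOn.div ?_ fun z hz => dslope_exp_zero_ne_zero hz
  exact (differentiableOn_dslope (Metric.ball_mem_nhds _ Real.two_pi_pos)).mpr
    differentiable_exp.differentiableOn

lemma bernoulliGenFun_mul_exp_sub_one {z : ℂ} (hz : z ∈ Metric.ball (0 : ℂ) (2 * Real.pi)) :
    bernoulliGenFun z * (exp z - 1) = z * exp z := by
  rw [exp_sub_one_eq_mul_dslope, bernoulliGenFun]
  field_simp [dslope_exp_zero_ne_zero hz]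

lemma iteratedDeriv_id_mul_exp (n : ℕ) :
    iteratedDeriv n (fun z : ℂ => z * exp z) = fun z => (z + n) * exp z := by
  induction n with
  | zero => simp
  | succ n ih =>
    rw [iteratedDeriv_succ, ih]
    ext z
    have h : HasDerivAt (fun z : ℂ => (z + n) * exp z) (1 * exp z + (z + n) * exp z) z :=
      ((hasDerivAt_id z).add_const _).mul (hasDerivAt_exp z)
    rw [h.deriv]
    push_cast
    ring

lemma iteratedDeriv_exp_sub_one_zero (n : ℕ) :
    iteratedDeriv n (fun z : ℂ => exp z - 1) 0 = if n = 0 then 0 else 1 := by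
  rcases n.eq_zero_or_pos with rfl | hn
  · simp
  · rw [iteratedDeriv_fun_sub contDiff_exp.contDiffAt contDiffAt_const, iteratedDeriv_const,
      iteratedDeriv_eq_iterate, iter_deriv_exp]
    simp [hn.ne']

lemma sum_choose_mul_iteratedDeriv_bernoulliGenFun (n : ℕ) :
    ∑ k ∈ Finset.range n, (n.choose k : ℂ) * iteratedDeriv k bernoulliGenFun 0 = n := by
  have hball : Metric.ball (0 : ℂ) (2 * Real.pi) ∈ nhds 0 :=
    Metric.ball_mem_nhds _ Real.two_pi_pos
  have hf : ContDiffAt ℂ n bernoulliGenFun 0 :=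
    (differentiableOn_bernoulliGenFun.analyticAt hball).contDiffAt
  have hg : ContDiffAt ℂ n (fun z : ℂ => exp z - 1) 0 :=
    (contDiff_exp.sub contDiff_const).contDiffAt
  have h : iteratedDeriv n (fun z => bernoulliGenFun z * (exp z - 1)) 0 = n := by
    rw [Filter.EventuallyEq.iteratedDeriv_eq n (g := fun z : ℂ => z * exp z)
      (Filter.mem_of_superset hball fun z hz => bernoulliGenFun_mul_exp_sub_one hz),
      iteratedDeriv_id_mul_exp]
    simp
  rw [iteratedDeriv_fun_mul hf hg, Finset.sum_range_succ, Nat.sub_self,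
    iteratedDeriv_exp_sub_one_zero, if_pos rfl, mul_zero, add_zero] at h
  rw [← h]
  refine Finset.sum_congr rfl fun k hk => ?_
  rw [iteratedDeriv_exp_sub_one_zero,
    if_neg (Nat.sub_ne_zero_of_lt (Finset.mem_range.mp hk)), mul_one]

lemma iteratedDeriv_bernoulliGenFun_zero (n : ℕ) :
    iteratedDeriv n bernoulliGenFun 0 = (bernoulli' n : ℂ) := by
  induction n using Nat.strong_induction_on with
  | _ n ih =>
    have h1 := sum_choose_mul_iteratedDeriv_bernoulliGenFun (n + 1)
    have h2 : ∑ k ∈ Finset.range (n + 1), ((n + 1).choose k : ℂ) * (bernoulli' k : ℂ)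
        = (n + 1 : ℕ) := by
      exact_mod_cast congrArg (Rat.cast : ℚ → ℂ) (sum_bernoulli' (n + 1))
    rw [← h2, Finset.sum_range_succ, Finset.sum_range_succ,
      Finset.sum_congr rfl fun k hk => by rw [ih k (Finset.mem_range.mp hk)]] at h1
    refine mul_left_cancel₀ ?_ (add_left_cancel h1)
    simp [Nat.cast_add_one_ne_zero]

lemma hasSum_bernoulliGenFun {z : ℂ} (hz : z ∈ Metric.ball (0 : ℂ) (2 * Real.pi)) :
    HasSum (fun n : ℕ => (bernoulli' n : ℂ) * z ^ n / (n.factorial : ℂ))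
      (bernoulliGenFun z) := by
  convert! hasSum_taylorSeries_on_ball differentiableOn_bernoulliGenFun hz using 2 with n
  rw [iteratedDeriv_bernoulliGenFun_zero, smul_eq_mul, smul_eq_mul, sub_zero]
  ring

lemma hasSum_riemannZeta_neg_nat {z : ℂ} (hz : z ∈ Metric.ball (0 : ℂ) (2 * Real.pi)) :
    HasSum (fun i : ℕ => riemannZeta (-(i : ℂ)) * z ^ i / (Nat.factorial i : ℂ))
      (-dslope bernoulliGenFun 0 z) := by
  rcases eq_or_ne z 0 with rfl | h0
  · rw [dslope_same, ← iteratedDeriv_one, iteratedDeriv_bernoulliGenFun_zero]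
    convert! hasSum_single (f := fun i : ℕ =>
      riemannZeta (-(i : ℂ)) * 0 ^ i / (Nat.factorial i : ℂ)) 0 ?_ using 1
    · simp [riemannZeta_zero, bernoulli'_one]
      norm_num
    · intro i hi
      simp [hi]
  · have h := (hasSum_nat_add_iff' 1).mpr (hasSum_bernoulliGenFun hz)
    convert! (h.div_const (-z)) using 1
    · ext i
      have hi : (i : ℂ) + 1 ≠ 0 := Nat.cast_add_one_ne_zero i
      have hfac : (i.factorial : ℂ) ≠ 0 := mod_cast i.factorial_ne_zero
      rw [riemannZeta_neg_nat_eq_bernoulli', Nat.factorial_succ]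
      push_cast
      field_simp
      ring
    · rw [dslope_of_ne _ h0, slope_def_field, bernoulliGenFun_zero]
      simp [div_neg]

/-- For `Re ε < 0`, `∑_{n≥1} e^{nε} = e^ε/(1-e^ε)`; moreover `e^ε/(1-e^ε) + 1/ε` extends
holomorphically to the disc `|ε| < 2π`, with Taylor expansion `∑_{i≥0} ζ(-i) ε^i / i!` at
`0`, where `ζ` is the Riemann zeta function. -/
theorem geometric_sum_and_zeta_expansion :
    (∀ ε : ℂ, ε.re < 0 →
      HasSum (fun n : ℕ => Complex.exp (((n : ℂ) + 1) * ε))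
        (Complex.exp ε / (1 - Complex.exp ε))) ∧
    ∃ G : ℂ → ℂ,
      DifferentiableOn ℂ G (Metric.ball (0 : ℂ) (2 * Real.pi)) ∧
      (∀ ε : ℂ, ε ∈ Metric.ball (0 : ℂ) (2 * Real.pi) → ε ≠ 0 →
        G ε = Complex.exp ε / (1 - Complex.exp ε) + 1 / ε) ∧
      (∀ ε : ℂ, ε ∈ Metric.ball (0 : ℂ) (2 * Real.pi) →
        HasSum (fun i : ℕ => riemannZeta (-(i : ℂ)) * ε ^ i / (Nat.factorial i : ℂ)) (G ε)) := by
  refine ⟨fun ε hε => ?_, fun z => -dslope bernoulliGenFun 0 z, ?_, fun ε hε h0 => ?_,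
    fun ε hε => hasSum_riemannZeta_neg_nat hε⟩
  · have h : ‖exp ε‖ < 1 := by rwa [norm_exp, Real.exp_lt_one_iff]
    convert! (hasSum_geometric_of_norm_lt_one h).mul_left (exp ε) using 1
    ext n
    rw [add_mul, one_mul, exp_add, exp_nat_mul, mul_comm]
  · exact ((differentiableOn_dslope (Metric.ball_mem_nhds _ Real.two_pi_pos)).mpr
      differentiableOn_bernoulliGenFun).neg
  · have hexp : exp ε - 1 ≠ 0 := by
      rw [exp_sub_one_eq_mul_dslope]
      exact mul_ne_zero h0 (dslope_exp_zero_ne_zero hε)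
    have hexp' : 1 - exp ε ≠ 0 := by rwa [← neg_sub, neg_ne_zero]
    beta_reduce
    rw [dslope_of_ne _ h0, slope_def_field, bernoulliGenFun_zero,
      eq_div_of_mul_eq hexp (bernoulliGenFun_mul_exp_sub_one hε), sub_zero]
    field_simp
    ring
end

section
/- Let k ≥ 2, let s = (s_1, …, s_k) ∈ ℤ^k with s_i ≤ 0 for all i, let r = (r_1, …, r_k) with each r_i > 0, and let ε ∈ ℂ with Re(ε) < 0. Then Z(s, r; ε) = ∑_{j=0}^{−s_1} C(−s_1, j) · Z((−j), (r_1); ε) · Z((s_1 + s_2 + j, s_3, …, s_k), (r_1 + r_2, r_3, …, r_k); ε), where C(−s_1, j) is the binomial coefficient. -/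
theorem hasSum_mul_of_summable_norm {ι κ : Type*} {f : ι → ℂ} {g : κ → ℂ}
    (hf : Summable fun i => ‖f i‖) (hg : Summable fun j => ‖g j‖) :
    HasSum (fun p : ι × κ => f p.1 * g p.2) ((∑' i, f i) * ∑' j, g j) :=
  hf.of_norm.hasSum.mul hg.of_norm.hasSum (summable_mul_of_summable_norm hf hg)

/-- Products of absolutely summable sequences are absolutely summable over `Fin k → ℕ`. -/
theorem summable_norm_fin_prod (k : ℕ) (f : Fin k → ℕ → ℂ) (hf : ∀ i, Summable fun n => ‖f i n‖) :
    Summable fun n : Fin k → ℕ => ‖∏ i, f i (n i)‖ := by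
  induction k with
  | zero => exact Summable.of_finite
  | succ k ih =>
    rw [← (Fin.consEquiv fun _ : Fin (k + 1) => ℕ).summable_iff]
    refine ((hf 0).mul_norm (ih (fun i => f i.succ) fun i => hf i.succ)).congr fun p => ?_
    simp [Fin.consEquiv, Fin.prod_univ_succ]

theorem summable_norm_exp_div_zpow (s : ℤ) (hs : s ≤ 0) (r : ℝ) (hr : 0 < r) (ε : ℂ)
    (hε : ε.re < 0) :
    Summable fun n : ℕ => ‖Complex.exp ((n : ℂ) * (r : ℂ) * ε) / (n : ℂ) ^ s‖ := by
  obtain ⟨a, rfl⟩ : ∃ a : ℕ, s = -(a : ℤ) := ⟨(-s).toNat, by omega⟩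
  have h : ‖Complex.exp (r * ε)‖ < 1 := by
    rw [Complex.norm_exp, Real.exp_lt_one_iff]
    simpa using mul_neg_of_pos_of_neg hr hε
  refine (summable_norm_pow_mul_geometric_of_norm_lt_one a h).congr fun n => ?_
  rw [← Complex.exp_nat_mul, zpow_neg, div_inv_eq_mul, zpow_natCast, mul_comm, mul_assoc]

theorem summable_norm_Zreg (k : ℕ) (s : Fin k → ℤ) (hs : ∀ i, s i ≤ 0) (r : Fin k → ℝ)
    (hr : ∀ i, 0 < r i) (ε : ℂ) (hε : ε.re < 0) :
    Summable fun n : DecSeq k =>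
      ‖∏ i, Complex.exp ((n.1 i : ℂ) * (r i : ℂ) * ε) / ((n.1 i : ℂ) ^ (s i))‖ :=
  (summable_norm_fin_prod k
    (fun i n => Complex.exp ((n : ℂ) * (r i : ℂ) * ε) / ((n : ℂ) ^ (s i)))
    fun i => summable_norm_exp_div_zpow (s i) (hs i) (r i) (hr i) ε hε).comp_injective
      Subtype.val_injective

/-- Splitting off the gap between the two largest entries of a decreasing tuple. -/
def DecSeq.gapEquiv (k : ℕ) : DecSeq 1 × DecSeq (k + 1) ≃ DecSeq (k + 2) where
  toFun p := ⟨Fin.cons (p.1.1 0 + p.2.1 0) p.2.1, by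
    have h := p.1.2.2 0
    constructor
    · rw [Fin.strictAnti_iff_succ_lt]
      intro i
      refine Fin.cases ?_ (fun i => ?_) i
      · simpa using h
      · simpa [← Fin.succ_castSucc] using p.2.2.1 (Fin.castSucc_lt_succ (i := i))
    · intro i
      refine Fin.cases ?_ (fun i => ?_) i
      · simpa using Or.inl h
      · simpa using p.2.2.2 i⟩
  invFun n := (⟨fun _ => n.1 0 - n.1 1, Subsingleton.strictAnti _, fun _ =>
      Nat.sub_pos_of_lt (n.2.1 (Fin.succ_pos 0))⟩,
    ⟨fun i => n.1 i.succ, n.2.1.comp_strictMono (Fin.strictMono_succ), fun i => n.2.2 i.succ⟩)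
  left_inv p := by
    refine Prod.ext (Subtype.ext (funext fun i => ?_)) (Subtype.ext (funext fun i => ?_))
    · have h1 : (Fin.cons (p.1.1 0 + p.2.1 0) p.2.1 : Fin (k + 2) → ℕ) 1 = p.2.1 0 := rfl
      simp [h1, Subsingleton.elim i 0]
    · simp
  right_inv n := by
    refine Subtype.ext (funext fun i => ?_)
    refine Fin.cases ?_ (fun i => ?_) i
    · have h : n.1 1 < n.1 0 := n.2.1 (Fin.succ_pos 0)
      simpa using Nat.sub_add_cancel h.le
    · simp

theorem DecSeq.gapEquiv_apply_zero (k : ℕ) (p : DecSeq 1 × DecSeq (k + 1)) :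
    (DecSeq.gapEquiv k p).1 0 = p.1.1 0 + p.2.1 0 := rfl

theorem DecSeq.gapEquiv_apply_succ (k : ℕ) (p : DecSeq 1 × DecSeq (k + 1)) (i : Fin (k + 1)) :
    (DecSeq.gapEquiv k p).1 i.succ = p.2.1 i := rfl

/-- Binomial expansion of the leading two factors in terms of the gap `m`. -/
theorem exp_div_zpow_mul_eq_sum (m p a : ℕ) (hp : 0 < p) (t : ℤ) (x y : ℝ) (ε : ℂ) :
    Complex.exp (((m + p : ℕ) : ℂ) * (x : ℂ) * ε) / ((m + p : ℕ) : ℂ) ^ (-(a : ℤ)) *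
        (Complex.exp ((p : ℂ) * (y : ℂ) * ε) / (p : ℂ) ^ t) =
      ∑ j ∈ Finset.range (a + 1), (Nat.choose a j : ℂ) *
        (Complex.exp ((m : ℂ) * (x : ℂ) * ε) / (m : ℂ) ^ (-(j : ℤ))) *
        (Complex.exp ((p : ℂ) * ((x + y : ℝ) : ℂ) * ε) / (p : ℂ) ^ (-(a : ℤ) + t + j)) := by
  have hp' : (p : ℂ) ≠ 0 := by exact_mod_cast hp.ne'
  have hexp : Complex.exp (((m + p : ℕ) : ℂ) * (x : ℂ) * ε) * Complex.exp ((p : ℂ) * (y : ℂ) * ε) =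
      Complex.exp ((m : ℂ) * (x : ℂ) * ε) * Complex.exp ((p : ℂ) * ((x + y : ℝ) : ℂ) * ε) := by
    rw [← Complex.exp_add, ← Complex.exp_add]
    push_cast
    ring_nf
  calc _ = (Complex.exp (((m + p : ℕ) : ℂ) * (x : ℂ) * ε) *
          Complex.exp ((p : ℂ) * (y : ℂ) * ε)) * ((m + p : ℂ) ^ a) / (p : ℂ) ^ t := by
        rw [zpow_neg, div_inv_eq_mul, zpow_natCast]
        push_cast
        ring
    _ = _ := by
      rw [hexp, add_pow, Finset.mul_sum, Finset.sum_div]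
      refine Finset.sum_congr rfl fun j hj => ?_
      obtain ⟨b, rfl⟩ := Nat.exists_eq_add_of_le (Nat.lt_succ_iff.mp (Finset.mem_range.mp hj))
      have hz : (p : ℂ) ^ (-((j + b : ℕ) : ℤ) + t + j) = (p : ℂ) ^ t / (p : ℂ) ^ b := by
        rw [← zpow_natCast (p : ℂ) b, ← zpow_sub₀ hp']
        congr 1
        push_cast
        ring
      rw [hz, zpow_neg, div_inv_eq_mul, zpow_natCast, Nat.add_sub_cancel_left, div_div_eq_mul_div]
      ring

/-- For `k ≥ 2` and nonpositive arguments,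
`Z(s, r; ε) = ∑_{j=0}^{-s₁} C(-s₁, j) Z((-j),(r₁); ε) ·
Z((s₁+s₂+j, s₃, …, s_k), (r₁+r₂, r₃, …, r_k); ε)`. -/
theorem Zreg_recursion (k : ℕ) (s : Fin (k + 2) → ℤ) (hs : ∀ i, s i ≤ 0)
    (r : Fin (k + 2) → ℝ) (hr : ∀ i, 0 < r i) (ε : ℂ) (hε : ε.re < 0) :
    Zreg (k + 2) s r ε =
      ∑ j ∈ Finset.range ((-s 0).toNat + 1),
        (Nat.choose (-s 0).toNat j : ℂ) *
          Zreg 1 (fun _ => -(j : ℤ)) (fun _ => r 0) ε *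
          Zreg (k + 1)
            (fun i => if i = 0 then s 0 + s 1 + (j : ℤ) else s i.succ)
            (fun i => if i = 0 then r 0 + r 1 else r i.succ) ε := by
  have hsum : ∀ j ∈ Finset.range ((-s 0).toNat + 1),
      HasSum (fun p : DecSeq 1 × DecSeq (k + 1) => (Nat.choose (-s 0).toNat j : ℂ) *
          ((∏ i, Complex.exp ((p.1.1 i : ℂ) * (r 0 : ℂ) * ε) / ((p.1.1 i : ℂ) ^ (-(j : ℤ)))) *
          ∏ i, Complex.exp ((p.2.1 i : ℂ) *
              ((if i = 0 then r 0 + r 1 else r i.succ : ℝ) : ℂ) * ε) /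
            ((p.2.1 i : ℂ) ^ (if i = 0 then s 0 + s 1 + (j : ℤ) else s i.succ))))
        ((Nat.choose (-s 0).toNat j : ℂ) *
          (Zreg 1 (fun _ => -(j : ℤ)) (fun _ => r 0) ε *
          Zreg (k + 1)
            (fun i => if i = 0 then s 0 + s 1 + (j : ℤ) else s i.succ)
            (fun i => if i = 0 then r 0 + r 1 else r i.succ) ε)) := by
    intro j hj
    have h₁ := summable_norm_Zreg 1 (fun _ => -(j : ℤ)) (fun _ => by omega) (fun _ => r 0)
      (fun _ => hr 0) ε hε
    have h₂ := summable_norm_Zreg (k + 1)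
      (fun i => if i = 0 then s 0 + s 1 + (j : ℤ) else s i.succ)
      (fun i => by
        have := hs 0
        have := hs 1
        have := hs i.succ
        have := Finset.mem_range.mp hj
        split_ifs <;> omega)
      (fun i => if i = 0 then r 0 + r 1 else r i.succ)
      (fun i => by
        have := hr 0
        have := hr 1
        have := hr i.succ
        split_ifs <;> linarith) ε hε
    exact (hasSum_mul_of_summable_norm h₁ h₂).mul_left (Nat.choose (-s 0).toNat j : ℂ)
  simp only [mul_assoc (Nat.cast _ : ℂ)]
  refine Eq.trans ?_ (hasSum_sum hsum).tsum_eq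
  rw [Zreg, ← (DecSeq.gapEquiv k).tsum_eq]
  refine tsum_congr fun p => ?_
  have ha : s 0 = -((-s 0).toNat : ℤ) := by
    have := hs 0
    omega
  have key := exp_div_zpow_mul_eq_sum (p.1.1 0) (p.2.1 0) (-s 0).toNat (p.2.2.2 0) (s 1) (r 0)
    (r 1) ε
  rw [← ha] at key
  rw [Fin.prod_univ_succ, Fin.prod_univ_succ, ← mul_assoc]
  simp only [DecSeq.gapEquiv_apply_zero, DecSeq.gapEquiv_apply_succ]
  refine (congrArg (· * _) key).trans ?_
  rw [Finset.sum_mul]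
  refine Finset.sum_congr rfl fun j _ => ?_
  rw [Fin.prod_univ_succ (n := k)]
  simp [Fin.succ_ne_zero, mul_assoc]
end

section
/- Let k ≥ 1 and s = (s_1, …, s_k) ∈ ℤ^k with s_i ≥ 1 for all i and s_1 ≥ 2, and let r = (r_1, …, r_k) with each r_i > 0. Then the nested sum defining Z(s, r; ε) converges uniformly for real ε ∈ (−∞, 0], the function ε ↦ Z(s, r; ε) is continuous on (−∞, 0], and lim_{ε→0⁻} Z(s, r; ε) = ζ(s_1, …, s_k) := ∑_{n_1 > n_2 > ⋯ > n_k > 0} 1/(n_1^{s_1} ⋯ n_k^{s_k}), the (convergent) multiple zeta value. In particular the limit is independent of the direction vector r. (This is the content of the theorem asserting that for convergent arguments the renormalized directional MZV ζ(s; r) equals ζ(s) for every r.) -/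
open Filter

/-- A finite product of nonnegative summable families is summable over the product index. -/
theorem summable_pi_prod_of_nonneg {ι α : Type*} [Fintype ι] {f : ι → α → ℝ}
    (hf0 : ∀ i a, 0 ≤ f i a) (hf : ∀ i, Summable (f i)) :
    Summable fun n : ι → α => ∏ i, f i (n i) := by
  classical
  refine summable_of_sum_le (c := ∏ i, ∑' a, f i a)
    (fun n => Finset.prod_nonneg fun i _ => hf0 i _) fun u => ?_
  calc ∑ n ∈ u, ∏ i, f i (n i)
      ≤ ∑ n ∈ Fintype.piFinset fun i => u.image fun n => n i, ∏ i, f i (n i) := by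
        refine Finset.sum_le_sum_of_subset_of_nonneg (fun n hn => ?_)
          fun n _ _ => Finset.prod_nonneg fun i _ => hf0 i _
        exact Fintype.mem_piFinset.2 fun i => Finset.mem_image_of_mem (fun n => n i) hn
    _ = ∏ i, ∑ a ∈ u.image fun n => n i, f i a := (Finset.prod_univ_sum _ _).symm
    _ ≤ ∏ i, ∑' a, f i a :=
        Finset.prod_le_prod (fun i _ => Finset.sum_nonneg fun a _ => hf0 i a)
          fun i _ => (hf i).sum_le_tsum _ fun a _ => hf0 i a

/-- Since the first entry is the largest, one factor of it can be spread evenly over all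
entries. -/
theorem DecSeq.prod_rpow_le_prod_zpow {k : ℕ} {s : Fin k → ℤ} {o : Fin k}
    (ho : ∀ i, o ≤ i) (hs : ∀ i, 1 ≤ s i) (hso : 2 ≤ s o) (n : DecSeq k) :
    ∏ i, (n.1 i : ℝ) ^ (1 + 1 / (k : ℝ)) ≤ ∏ i, (n.1 i : ℝ) ^ s i := by
  obtain ⟨n, hn, hpos⟩ := n
  dsimp only
  have hk0 : (k : ℝ) ≠ 0 := Nat.cast_ne_zero.2 o.pos.ne'
  have hone (i : Fin k) : (1 : ℝ) ≤ n i := by exact_mod_cast hpos i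
  have hle (i : Fin k) : (n i : ℝ) ≤ n o := by
    exact_mod_cast hn.antitone (ho i)
  have hroot : ∏ i, (n i : ℝ) ^ (1 / (k : ℝ)) ≤ n o := by
    calc ∏ i, (n i : ℝ) ^ (1 / (k : ℝ)) ≤ ∏ _i : Fin k, (n o : ℝ) ^ (1 / (k : ℝ)) :=
          Finset.prod_le_prod (fun i _ => by positivity)
            fun i _ => Real.rpow_le_rpow (by positivity) (hle i) (by positivity)
      _ = n o := by
          rw [Finset.prod_const, Finset.card_univ, Fintype.card_fin, ← Real.rpow_natCast,
            ← Real.rpow_mul (by positivity), one_div_mul_cancel hk0, Real.rpow_one]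
  calc ∏ i, (n i : ℝ) ^ (1 + 1 / (k : ℝ))
      = (∏ i, (n i : ℝ)) * ∏ i, (n i : ℝ) ^ (1 / (k : ℝ)) := by
        rw [← Finset.prod_mul_distrib]
        refine Finset.prod_congr rfl fun i _ => ?_
        rw [Real.rpow_add (by linarith [hone i]), Real.rpow_one]
    _ ≤ (∏ i, (n i : ℝ)) * n o := by gcongr
    _ = ∏ i, (n i : ℝ) ^ (if i = o then 2 else 1 : ℤ) := by
        rw [← Finset.mul_prod_erase _ _ (Finset.mem_univ o),
          ← Finset.mul_prod_erase _ (fun i => (n i : ℝ) ^ (if i = o then 2 else 1 : ℤ))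
            (Finset.mem_univ o), if_pos rfl, Finset.prod_congr rfl (fun i hi => by
              rw [if_neg (Finset.ne_of_mem_erase hi), zpow_one] :
              ∀ i ∈ Finset.univ.erase o,
                (n i : ℝ) ^ (if i = o then 2 else 1 : ℤ) = n i), zpow_ofNat]
        ring
    _ ≤ ∏ i, (n i : ℝ) ^ s i := by
        refine Finset.prod_le_prod (fun i _ => by positivity) fun i _ =>
          zpow_le_zpow_right₀ (hone i) ?_
        split_ifs with h
        · exact h ▸ hso
        · exact hs i

/-- Absolute convergence of the multiple zeta series for convergent arguments. -/
theorem DecSeq.summable_prod_one_div_zpow {k : ℕ} {s : Fin k → ℤ} {o : Fin k}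
    (ho : ∀ i, o ≤ i) (hs : ∀ i, 1 ≤ s i) (hso : 2 ≤ s o) :
    Summable fun n : DecSeq k => ∏ i, 1 / (n.1 i : ℝ) ^ s i := by
  have hk0 : (0 : ℝ) < 1 / k := one_div_pos.2 (Nat.cast_pos.2 o.pos)
  have hpi : Summable fun n : Fin k → ℕ => ∏ i, 1 / (n i : ℝ) ^ (1 + 1 / (k : ℝ)) :=
    summable_pi_prod_of_nonneg (f := fun _ (m : ℕ) => 1 / (m : ℝ) ^ (1 + 1 / (k : ℝ)))
      (fun _ _ => by positivity) fun _ => Real.summable_one_div_nat_rpow.2 (by linarith)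
  refine (hpi.comp_injective (i := fun n : DecSeq k => n.1)
    Subtype.val_injective).of_nonneg_of_le
    (fun n => Finset.prod_nonneg fun i _ => by positivity) fun n => ?_
  have hpos (i : Fin k) : (0 : ℝ) < n.1 i := by exact_mod_cast n.2.2 i
  simp only [Function.comp_apply, Finset.prod_div_distrib, Finset.prod_const_one]
  exact one_div_le_one_div_of_le
    (Finset.prod_pos fun i _ => Real.rpow_pos_of_pos (hpos i) _)
    (n.prod_rpow_le_prod_zpow ho hs hso)

/-- For `ε ≤ 0` the exponential factors only decrease the terms of the series. -/
theorem DecSeq.norm_prod_exp_div_zpow_le {k : ℕ} (s : Fin k → ℤ) {r : Fin k → ℝ}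
    (hr : ∀ i, 0 < r i) (n : DecSeq k) {ε : ℝ} (hε : ε ≤ 0) :
    ‖∏ i, Complex.exp ((n.1 i : ℂ) * (r i : ℂ) * (ε : ℂ)) / ((n.1 i : ℂ) ^ (s i))‖ ≤
      ∏ i, 1 / (n.1 i : ℝ) ^ s i := by
  rw [norm_prod]
  refine Finset.prod_le_prod (fun i _ => norm_nonneg _) fun i _ => ?_
  rw [norm_div, norm_zpow, Complex.norm_natCast, Complex.norm_exp]
  gcongr
  have : ((n.1 i : ℂ) * (r i : ℂ) * (ε : ℂ)).re = n.1 i * r i * ε := by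
    norm_cast
  rw [this, Real.exp_le_one_iff]
  exact mul_nonpos_of_nonneg_of_nonpos (mul_nonneg (Nat.cast_nonneg _) (hr i).le) hε

/-- For convergent arguments (`sᵢ ≥ 1`, `s₁ ≥ 2`) the nested sum defining `Z(s, r; ε)`
converges uniformly on `(-∞, 0]`, is continuous there, and tends, as `ε → 0⁻`, to the
classical multiple zeta value `ζ(s₁,…,s_k)`, independently of the direction vector `r`. -/
theorem Zreg_tendsto_mzv_of_convergent (k : ℕ) (hk : 1 ≤ k) (s : Fin k → ℤ)
    (hs : ∀ i, 1 ≤ s i) (hs1 : 2 ≤ s ⟨0, by omega⟩)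
    (r : Fin k → ℝ) (hr : ∀ i, 0 < r i) :
    TendstoUniformlyOn
      (fun (F : Finset (DecSeq k)) (ε : ℝ) =>
        ∑ n ∈ F, ∏ i, Complex.exp ((n.1 i : ℂ) * (r i : ℂ) * (ε : ℂ)) / ((n.1 i : ℂ) ^ (s i)))
      (fun ε : ℝ => Zreg k s r (ε : ℂ)) atTop (Set.Iic (0 : ℝ)) ∧
    ContinuousOn (fun ε : ℝ => Zreg k s r (ε : ℂ)) (Set.Iic (0 : ℝ)) ∧
    Tendsto (fun ε : ℝ => Zreg k s r (ε : ℂ)) (nhdsWithin 0 (Set.Iio (0 : ℝ)))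
      (nhds (∑' n : DecSeq k, ∏ i, 1 / ((n.1 i : ℂ) ^ (s i)))) := by
  have hsum := DecSeq.summable_prod_one_div_zpow
    (fun i => Fin.le_def.2 (Nat.zero_le _)) hs hs1
  have hcont : ContinuousOn (fun ε : ℝ => Zreg k s r (ε : ℂ)) (Set.Iic (0 : ℝ)) :=
    continuousOn_tsum
      (fun n => by
        simp only [div_eq_mul_inv]
        fun_prop)
      hsum fun n ε hε => n.norm_prod_exp_div_zpow_le s hr hε
  refine ⟨tendstoUniformlyOn_tsum hsum fun n ε hε => n.norm_prod_exp_div_zpow_le s hr hε,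
    hcont, ?_⟩
  have hlim := (hcont 0 Set.self_mem_Iic).mono Set.Iio_subset_Iic_self
  simpa only [ContinuousWithinAt, Zreg, Complex.ofReal_zero, mul_zero, Complex.exp_zero]
    using hlim
end
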